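/- Let u be real analytic and v₁,…,v_k harmonic on a domain Ω ⊆ ℝ^n (n ≥ 2), each v_i not identically zero, with Z(v_i) ⊆ Z(u) for each i and H^{n−1}(Z(v_i) ∩ Z(v_j)) = 0 for i ≠ j. Then there exists a real analytic function f on Ω such that u = f · ∏_{i=1}^k v_i. -/

import Mathlib

open MeasureTheory

/-- `f` is harmonic on `s`: it is `C²` there and its Laplacian vanishes. -/
def IsHarmonicOn {n : ℕ} (f : (Fin n → ℝ) → ℝ) (s : Set (Fin n → ℝ)) : Prop :=
  ContDiffOn ℝ 2 f s ∧
    ∀ x ∈ s, ∑ i : Fin n, iteratedFDeriv ℝ 2 f x (fun _ => Pi.single i 1) = 0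

/-- Points at which `f` takes positive and negative values in every neighbourhood. -/
def signChangeSet {X : Type*} [TopologicalSpace X] (f : X → ℝ) : Set X :=
  closure {x | 0 < f x} ∩ closure {x | f x < 0}

theorem eq_zero_of_mem_signChangeSet {X : Type*} [TopologicalSpace X] {f : X → ℝ} {z : X}
    (hz : z ∈ signChangeSet f) (hf : ContinuousAt f z) : f z = 0 := by
  rcases lt_trichotomy (f z) 0 with h | h | h
  · obtain ⟨x, hx, hx'⟩ := mem_closure_iff_nhds.1 hz.1 _ (hf.eventually_lt_const h)
    exact (lt_asymm (Set.mem_ofPred.1 hx) (Set.mem_ofPred.1 hx')).elim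
  · exact h
  · obtain ⟨x, hx, hx'⟩ := mem_closure_iff_nhds.1 hz.2 _ (hf.eventually_const_lt h)
    exact (lt_asymm (Set.mem_ofPred.1 hx) (Set.mem_ofPred.1 hx')).elim

theorem exists_mem_signChangeSet {X : Type*} [TopologicalSpace X] {f : X → ℝ} {s : Set X}
    (hs : IsPreconnected s) (hd : s ⊆ closure {x | f x ≠ 0}) {a b : X} (ha : a ∈ s) (hb : b ∈ s)
    (hfa : 0 < f a) (hfb : f b < 0) : ∃ z ∈ s, z ∈ signChangeSet f := by
  have hcover : s ⊆ closure {x | 0 < f x} ∪ closure {x | f x < 0} := by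
    rw [← closure_union]
    refine hd.trans (closure_mono fun x hx => ?_)
    exact (lt_or_gt_of_ne hx).symm
  obtain ⟨z, hz, hz'⟩ := isPreconnected_closed_iff.1 hs _ _ isClosed_closure isClosed_closure hcover
    ⟨a, ha, subset_closure hfa⟩ ⟨b, hb, subset_closure hfb⟩
  exact ⟨z, hz, hz'⟩

/-- Multiplying by a function that is continuous and nonzero at `z` keeps a sign change at `z`. -/
theorem mem_signChangeSet_mul {X : Type*} [TopologicalSpace X] {f h : X → ℝ} {z : X}
    (hz : z ∈ signChangeSet f) (hh : ContinuousAt h z) (hne : h z ≠ 0) :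
    z ∈ signChangeSet (fun x => f x * h x) := by
  rcases lt_or_gt_of_ne hne with hneg | hpos
  · have hev := hh.eventually_lt_const hneg
    constructor
    · rw [mem_closure_iff_frequently]
      exact ((mem_closure_iff_frequently.1 hz.2).and_eventually hev).mono
        fun x hx => mul_pos_of_neg_of_neg hx.1 hx.2
    · rw [mem_closure_iff_frequently]
      exact ((mem_closure_iff_frequently.1 hz.1).and_eventually hev).mono
        fun x hx => mul_neg_of_pos_of_neg hx.1 hx.2
  · have hev := hh.eventually_const_lt hpos
    constructor
    · rw [mem_closure_iff_frequently]
      exact ((mem_closure_iff_frequently.1 hz.1).and_eventually hev).mono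
        fun x hx => mul_pos hx.1 hx.2
    · rw [mem_closure_iff_frequently]
      exact ((mem_closure_iff_frequently.1 hz.2).and_eventually hev).mono
        fun x hx => mul_neg_of_neg_of_pos hx.1 hx.2

/-- Elimination: a monic irreducible polynomial and a polynomial it does not divide generate an
ideal containing a nonzero constant. -/
theorem Polynomial.Monic.exists_combination_eq_C {R : Type*} [CommRing R] [IsDomain R]
    [IsIntegrallyClosed R] {f g : Polynomial R} (hf : f.Monic) (hirr : Irreducible f)
    (hfg : ¬ f ∣ g) : ∃ (s r : Polynomial R) (d : R), d ≠ 0 ∧ s * f + r * g = Polynomial.C d := by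
  let K := FractionRing R
  have hinj := IsFractionRing.injective R K
  have hirrK : Irreducible (f.map (algebraMap R K)) :=
    hf.irreducible_iff_irreducible_map_fraction_map.1 hirr
  have hndvd : ¬ f.map (algebraMap R K) ∣ g.map (algebraMap R K) := by
    rwa [Polynomial.map_dvd_map _ hinj hf]
  obtain ⟨s, r, hsr⟩ := (EuclideanDomain.dvd_or_coprime _ _ hirrK).resolve_left hndvd
  obtain ⟨b, hb0, hb⟩ := IsLocalization.integerNormalization_spec (nonZeroDivisors R) s
  obtain ⟨c, hc0, hc⟩ := IsLocalization.integerNormalization_spec (nonZeroDivisors R) r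
  set s' := IsLocalization.integerNormalization (nonZeroDivisors R) s
  set r' := IsLocalization.integerNormalization (nonZeroDivisors R) r
  refine ⟨Polynomial.C c * s', Polynomial.C b * r', c * b,
    mul_ne_zero (nonZeroDivisors.ne_zero hc0) (nonZeroDivisors.ne_zero hb0), ?_⟩
  apply Polynomial.map_injective (algebraMap R K) hinj
  simp only [Polynomial.map_add, Polynomial.map_mul, Polynomial.map_C, hb, hc, map_mul]
  rw [Algebra.smul_def, Algebra.smul_def, Polynomial.algebraMap_apply, Polynomial.algebraMap_apply]
  linear_combination (Polynomial.C (algebraMap R K c) * Polynomial.C (algebraMap R K b)) * hsr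

/-- A nonzero real polynomial does not vanish identically on any nonempty open set. -/
theorem MvPolynomial.exists_eval_ne_zero_of_isOpen {m : ℕ} {p : MvPolynomial (Fin m) ℝ}
    (hp : p ≠ 0) {U : Set (Fin m → ℝ)} (hU : IsOpen U) (hne : U.Nonempty) :
    ∃ x ∈ U, eval x p ≠ 0 := by
  by_contra! hcon
  obtain ⟨x, hx⟩ := hne
  obtain ⟨ε, hε, hball⟩ := Metric.isOpen_iff.1 hU x hx
  apply hp
  refine MvPolynomial.funext_set (fun i => Metric.ball (x i) ε) ?_ ?_
  · intro i
    rw [Real.ball_eq_Ioo]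
    exact Set.Ioo_infinite (by linarith)
  · intro y hy
    rw [map_zero]
    refine hcon y (hball ?_)
    rw [ball_pi _ hε]
    exact hy

theorem MvPolynomial.IsHomogeneous.eval_smul {m d : ℕ} {p : MvPolynomial (Fin m) ℝ}
    (hp : p.IsHomogeneous d) (s : ℝ) (x : Fin m → ℝ) : eval (s • x) p = s ^ d * eval x p := by
  rw [eval_eq', eval_eq', Finset.mul_sum]
  refine Finset.sum_congr rfl fun α hα => ?_
  have hd : ∑ i, α i = d := by
    rw [← Finsupp.degree_eq_sum, Finsupp.degree_eq_weight_one]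
    exact hp (mem_support_iff.1 hα)
  simp only [Pi.smul_apply, smul_eq_mul, mul_pow, Finset.prod_mul_distrib, Finset.prod_pow_eq_pow_sum,
    hd]
  ring

namespace MvPolynomial

variable {m : ℕ}

/-- The substitution `X i ↦ X i + c i • X 0` for `i ≠ 0`, fixing `X 0`. -/
noncomputable def shearHom (c : Fin (m + 1) → ℝ) :
    MvPolynomial (Fin (m + 1)) ℝ →ₐ[ℝ] MvPolynomial (Fin (m + 1)) ℝ :=
  aeval fun i => if i = 0 then X 0 else X i + C (c i) * X 0

theorem shearHom_comp_neg (c : Fin (m + 1) → ℝ) :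
    (shearHom c).comp (shearHom (-c)) = AlgHom.id ℝ _ := by
  ext1 i
  by_cases hi : i = 0 <;> simp [shearHom, hi]

/-- The shear substitution as an algebra automorphism. -/
noncomputable def shear (c : Fin (m + 1) → ℝ) :
    MvPolynomial (Fin (m + 1)) ℝ ≃ₐ[ℝ] MvPolynomial (Fin (m + 1)) ℝ :=
  AlgEquiv.ofAlgHom (shearHom c) (shearHom (-c)) (shearHom_comp_neg c)
    (by simpa using shearHom_comp_neg (-c))

theorem natDegree_le_and_coeff_finSuccEquiv_shear_X {c : Fin (m + 1) → ℝ} (hc : c 0 = 1)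
    (i : Fin (m + 1)) : (finSuccEquiv ℝ m (shear c (X i))).natDegree ≤ 1 ∧
      (finSuccEquiv ℝ m (shear c (X i))).coeff 1 = C (c i) := by
  cases i using Fin.cases with
  | zero => simp [shear, shearHom, finSuccEquiv_X_zero, hc]
  | succ j =>
    have : finSuccEquiv ℝ m (shear c (X j.succ)) =
        Polynomial.C (X j) + Polynomial.C (C (c j.succ)) * Polynomial.X := by
      simp [shear, shearHom, finSuccEquiv_apply]
    rw [this]
    refine ⟨by compute_degree, by simp⟩

theorem natDegree_le_and_coeff_finSuccEquiv_shear_prod {c : Fin (m + 1) → ℝ} (hc : c 0 = 1)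
    (α : Fin (m + 1) →₀ ℕ) (s : Finset (Fin (m + 1))) :
    (∏ i ∈ s, finSuccEquiv ℝ m (shear c (X i)) ^ α i).natDegree ≤ ∑ i ∈ s, α i ∧
      (∏ i ∈ s, finSuccEquiv ℝ m (shear c (X i)) ^ α i).coeff (∑ i ∈ s, α i) =
        C (∏ i ∈ s, c i ^ α i) := by
  classical
  induction s using Finset.induction_on with
  | empty => simp
  | insert a s ha ih =>
    obtain ⟨h1, h2⟩ := natDegree_le_and_coeff_finSuccEquiv_shear_X hc a
    have h3 : (finSuccEquiv ℝ m (shear c (X a)) ^ α a).natDegree ≤ α a := by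
      simpa using Polynomial.natDegree_pow_le_of_le (α a) h1
    have h4 : (finSuccEquiv ℝ m (shear c (X a)) ^ α a).coeff (α a) = C (c a ^ α a) := by
      have := Polynomial.coeff_pow_of_natDegree_le (m := α a) h1
      rw [mul_one] at this
      rw [this, h2, map_pow]
    rw [Finset.prod_insert ha, Finset.sum_insert ha, Finset.prod_insert ha, map_mul]
    exact ⟨Polynomial.natDegree_mul_le_of_le h3 ih.1,
      by rw [Polynomial.coeff_mul_add_eq_of_natDegree_le h3 ih.1, h4, ih.2]⟩

theorem finSuccEquiv_shear_eq_sum (c : Fin (m + 1) → ℝ) (a : MvPolynomial (Fin (m + 1)) ℝ) :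
    finSuccEquiv ℝ m (shear c a) = ∑ α ∈ a.support, Polynomial.C (C (coeff α a)) *
      ∏ i, finSuccEquiv ℝ m (shear c (X i)) ^ α i := by
  conv_lhs => rw [a.as_sum]
  simp only [map_sum]
  refine Finset.sum_congr rfl fun α _ => ?_
  rw [monomial_eq, Finsupp.prod_fintype _ _ (fun i => pow_zero _)]
  simp only [map_mul, map_prod, map_pow]
  congr 1
  rw [← algebraMap_eq, AlgEquiv.commutes, AlgEquiv.commutes]
  rfl

/-- After a suitable shear, a nonzero polynomial has a constant leading coefficient with respect
to the zeroth variable. -/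
theorem exists_shear_leadingCoeff {a : MvPolynomial (Fin (m + 1)) ℝ} (ha : a ≠ 0) :
    ∃ (c : Fin (m + 1) → ℝ) (l : ℝ), l ≠ 0 ∧
      (finSuccEquiv ℝ m (shear c a)).leadingCoeff = C l := by
  set d := a.totalDegree with hd
  set H := homogeneousComponent d a with hH
  have hH0 : H ≠ 0 := by
    obtain ⟨α, hα, hsup⟩ := Finset.exists_mem_eq_sup a.support (support_nonempty.2 ha)
      fun α => α.sum fun _ e => e
    have hα' : α.degree = d := by
      rw [hd, totalDegree, hsup, Finsupp.sum_fintype _ _ (fun _ => rfl), Finsupp.degree_eq_sum]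
    intro h0
    have := congrArg (coeff α) h0
    rw [hH, coeff_homogeneousComponent, if_pos hα', coeff_zero] at this
    exact (mem_support_iff.1 hα) this
  obtain ⟨x, -, hx⟩ := exists_eval_ne_zero_of_isOpen (mul_ne_zero (X_ne_zero (0 : Fin (m + 1))) hH0)
    isOpen_univ Set.univ_nonempty
  rw [map_mul, eval_X] at hx
  have hx0 : x 0 ≠ 0 := left_ne_zero_of_mul hx
  have hxH : eval x H ≠ 0 := right_ne_zero_of_mul hx
  set c : Fin (m + 1) → ℝ := fun i => (x 0)⁻¹ * x i with hcdef
  have hc : c 0 = 1 := by simp [hcdef, hx0]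
  have hcH : eval c H ≠ 0 := by
    have h1 : H.IsHomogeneous d := homogeneousComponent_isHomogeneous d a
    have h2 : c = (x 0)⁻¹ • x := by ext i; simp [hcdef]
    rw [h2, h1.eval_smul]
    exact mul_ne_zero (pow_ne_zero _ (inv_ne_zero hx0)) hxH
  have hdeg : ∀ α ∈ a.support, ∑ i, α i ≤ d := fun α hα => by
    have := le_totalDegree hα
    rwa [Finsupp.sum_fintype _ _ (fun _ => rfl)] at this
  have hle : (finSuccEquiv ℝ m (shear c a)).natDegree ≤ d := by
    rw [finSuccEquiv_shear_eq_sum]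
    refine Polynomial.natDegree_sum_le_of_forall_le _ _ fun α hα => ?_
    exact (Polynomial.natDegree_C_mul_le _ _).trans
      ((natDegree_le_and_coeff_finSuccEquiv_shear_prod hc α Finset.univ).1.trans (hdeg α hα))
  have hcoeff : (finSuccEquiv ℝ m (shear c a)).coeff d = C (eval c H) := by
    rw [finSuccEquiv_shear_eq_sum, Polynomial.finsetSum_coeff, hH, homogeneousComponent_apply,
      map_sum, map_sum, Finset.sum_filter]
    refine Finset.sum_congr rfl fun α hα => ?_
    obtain ⟨h1, h2⟩ := natDegree_le_and_coeff_finSuccEquiv_shear_prod hc α Finset.univ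
    rw [Polynomial.coeff_C_mul]
    have hdα : α.degree = ∑ i, α i := Finsupp.degree_eq_sum α
    split_ifs with h
    · rw [← h, hdα, h2, eval_monomial, Finsupp.prod_fintype _ _ (fun i => pow_zero _), map_mul]
    · rw [Polynomial.coeff_eq_zero_of_natDegree_lt, mul_zero]
      exact h1.trans_lt (lt_of_le_of_ne (hdeg α hα) (hdα ▸ h))
  have hne : (finSuccEquiv ℝ m (shear c a)).coeff d ≠ 0 := by
    rw [hcoeff]
    simpa using hcH
  refine ⟨c, eval c H, hcH, ?_⟩
  rw [Polynomial.leadingCoeff, Polynomial.natDegree_eq_of_le_of_coeff_ne_zero hle hne, hcoeff]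

/-- An irreducible polynomial that takes both signs and divides `a * h` exactly once divides every
polynomial that vanishes wherever `a * h` changes sign. -/
theorem dvd_of_eval_eq_zero_on_signChangeSet {a h p : MvPolynomial (Fin (m + 1)) ℝ}
    (ha : Irreducible a) (hah : ¬ a ∣ h) {x y : Fin (m + 1) → ℝ} (hx : 0 < eval x a)
    (hy : eval y a < 0)
    (hp : ∀ z ∈ signChangeSet (fun z => eval z (a * h)), eval z p = 0) : a ∣ p := by
  by_contra hap
  have hndvd : ¬ a ∣ p * h := fun hd => (ha.prime.dvd_or_dvd hd).elim hap hah
  obtain ⟨c, l, hl, hlead⟩ := exists_shear_leadingCoeff ha.ne_zero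
  set θ : (Fin (m + 1) → ℝ) → Fin (m + 1) → ℝ := fun z i => eval z (shear c (X i)) with hθ
  have hθcont : Continuous θ := continuous_pi fun i => (shear c (X i)).continuous_eval
  have heval : ∀ (q : MvPolynomial (Fin (m + 1)) ℝ) z, eval z (shear c q) = eval (θ z) q := by
    intro q z
    have : (aeval z).comp (shear c).toAlgHom = (aeval (θ z) : _ →ₐ[ℝ] ℝ) := by
      ext1 i
      simp [hθ, aeval_eq_eval]
    simpa [aeval_eq_eval] using DFunLike.congr_fun this q
  have hθsurj : Function.Surjective θ := by
    intro w
    refine ⟨fun i => eval w ((shear c).symm (X i)), ?_⟩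
    set η : Fin (m + 1) → ℝ := fun i => eval w ((shear c).symm (X i)) with hη
    have : (aeval η).comp (shear c).toAlgHom = (aeval w : _ →ₐ[ℝ] ℝ) := by
      have h1 : (aeval η : _ →ₐ[ℝ] ℝ) = (aeval w).comp (shear c).symm.toAlgHom := by
        ext1 i
        simp [hη, aeval_eq_eval]
      rw [h1]
      ext1 i
      simp
    ext i
    simpa [hθ, aeval_eq_eval] using DFunLike.congr_fun this (X i)
  set F := finSuccEquiv ℝ m (shear c a) with hF
  set G := finSuccEquiv ℝ m (shear c (p * h)) with hG
  have hunit : IsUnit (Polynomial.C (C l⁻¹ : MvPolynomial (Fin m) ℝ)) :=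
    ((isUnit_iff_ne_zero.2 (inv_ne_zero hl)).map C).map Polynomial.C
  have hFirr : Irreducible F :=
    (MulEquiv.irreducible_iff ((shear c).trans (finSuccEquiv ℝ m))).2 ha
  have hFG : ¬ F ∣ G := by
    intro hd
    exact hndvd ((map_dvd_iff ((shear c).trans (finSuccEquiv ℝ m))).1 hd)
  set F' := Polynomial.C (C l⁻¹ : MvPolynomial (Fin m) ℝ) * F with hF'
  have hassoc : Associated F F' := (associated_unit_mul_left F _ hunit).symm
  have hmonic : F'.Monic := by
    rw [Polynomial.Monic, hF', Polynomial.leadingCoeff_mul, Polynomial.leadingCoeff_C, hlead,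
      ← map_mul, inv_mul_cancel₀ hl, map_one]
  obtain ⟨s, r, d, hd0, hsr⟩ := hmonic.exists_combination_eq_C (hassoc.irreducible hFirr)
    (fun hd => hFG (hassoc.dvd.trans hd))
  -- a point at which the sign of `a` is opposite to that of the leading coefficient
  obtain ⟨w, hw⟩ : ∃ w, l * eval w (shear c a) < 0 := by
    rcases lt_or_gt_of_ne hl with hneg | hpos
    · obtain ⟨w, rfl⟩ := hθsurj x
      exact ⟨w, by rw [heval]; exact mul_neg_of_neg_of_pos hneg hx⟩
    · obtain ⟨w, rfl⟩ := hθsurj y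
      exact ⟨w, by rw [heval]; exact mul_neg_of_pos_of_neg hpos hy⟩
  obtain ⟨ξ, hξ, hξd⟩ : ∃ ξ : Fin m → ℝ, l * eval (Fin.cons (w 0) ξ) (shear c a) < 0 ∧
      eval ξ d ≠ 0 := by
    have hcont : Continuous fun ξ : Fin m → ℝ =>
        l * eval (Fin.cons (w 0) ξ : Fin (m + 1) → ℝ) (shear c a) :=
      continuous_const.mul ((shear c a).continuous_eval.comp (continuous_const.finCons continuous_id))
    refine exists_eval_ne_zero_of_isOpen hd0 (hcont.isOpen_preimage _ isOpen_Iio) ⟨Fin.tail w, ?_⟩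
    change l * eval (Fin.cons (w 0) (Fin.tail w)) (shear c a) < 0
    rwa [Fin.cons_self_tail]
  -- restrict to the line over `ξ`
  have hline : ∀ (q : MvPolynomial (Fin (m + 1)) ℝ) (t : ℝ), eval (Fin.cons t ξ) q =
      Polynomial.eval t ((finSuccEquiv ℝ m q).map (eval ξ)) := by
    intro q t
    rw [eval_eq_eval_mv_eval']
  set P := (F.map (eval ξ)) with hP
  have hPlead : P.leadingCoeff = l := by
    rw [hP, Polynomial.leadingCoeff_map_of_leadingCoeff_ne_zero, hlead, eval_C]
    rw [hlead, eval_C]; exact hl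
  have hP0 : P ≠ 0 := by
    rw [← Polynomial.leadingCoeff_ne_zero, hPlead]; exact hl
  have hneg : l * P.eval (w 0) < 0 := by rw [hP, ← hline]; exact hξ
  have hdegP : 0 < P.degree := by
    by_contra hle
    rw [Polynomial.eq_C_of_degree_le_zero (not_lt.1 hle)] at hneg hPlead
    rw [Polynomial.eval_C] at hneg
    rw [Polynomial.leadingCoeff_C] at hPlead
    rw [hPlead] at hneg
    exact absurd hneg (not_lt.2 (mul_self_nonneg l))
  obtain ⟨t₁, ht₁⟩ : ∃ t, 0 < l * P.eval t := by
    have hlim := (Polynomial.C l * P).tendsto_atTop_of_leadingCoeff_nonneg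
      (by rw [Polynomial.degree_C_mul hl]; exact hdegP)
      (by rw [Polynomial.leadingCoeff_mul, Polynomial.leadingCoeff_C, hPlead]
          exact mul_self_nonneg l)
    obtain ⟨t, ht⟩ := (hlim.eventually_gt_atTop 0).exists
    exact ⟨t, by simpa using ht⟩
  obtain ⟨τ, -, hτ⟩ : ∃ τ ∈ Set.univ, τ ∈ signChangeSet (fun t => l * P.eval t) := by
    refine exists_mem_signChangeSet isPreconnected_univ (fun t _ => ?_) (Set.mem_univ t₁)
      (Set.mem_univ (w 0)) ht₁ hneg
    have hfin : {t | l * P.eval t = 0}.Finite := by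
      refine (P.roots.toFinset.finite_toSet).subset fun t ht => ?_
      simp only [Set.mem_ofPred_eq, mul_eq_zero, hl, false_or] at ht
      simpa [hP0] using ht
    exact hfin.countable.dense_compl ℝ t
  have hτ' : τ ∈ signChangeSet (fun t => P.eval t) := by
    have := mem_signChangeSet_mul (h := fun _ => l⁻¹) hτ continuousAt_const (inv_ne_zero hl)
    convert this using 3
    field_simp
  have hPτ : P.eval τ = 0 := eq_zero_of_mem_signChangeSet (f := fun t => P.eval t) hτ'
    P.continuous.continuousAt
  set z := θ (Fin.cons τ ξ) with hz
  have hza : z ∈ signChangeSet (fun z => eval z a) := by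
    have hc : Continuous fun t : ℝ => θ (Fin.cons t ξ) :=
      hθcont.comp (Continuous.finCons (A := fun _ => ℝ) continuous_id continuous_const)
    refine ⟨map_mem_closure hc hτ'.1 fun t ht => ?_, map_mem_closure hc hτ'.2 fun t ht => ?_⟩
    · simpa only [Set.mem_ofPred_eq, ← heval, hline] using ht
    · simpa only [Set.mem_ofPred_eq, ← heval, hline] using ht
  have hzb : eval z (p * h) ≠ 0 := by
    intro h0
    rw [hz, ← heval, hline] at h0
    have := congrArg (fun q => Polynomial.eval τ (q.map (eval ξ))) hsr
    simp only [Polynomial.map_add, Polynomial.map_mul, Polynomial.eval_add, Polynomial.eval_mul,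
      hF', Polynomial.map_C, Polynomial.eval_C, ← hP, hPτ] at this
    rw [hG, h0] at this
    apply hξd
    rw [← this]
    ring
  rw [map_mul] at hzb
  refine left_ne_zero_of_mul hzb (hp z ?_)
  have := mem_signChangeSet_mul hza h.continuous_eval.continuousAt (right_ne_zero_of_mul hzb)
  simpa only [map_mul] using this

/-- If `H` is squarefree and every irreducible factor of `H` takes both signs, then `H` divides
every polynomial that vanishes wherever `H` changes sign. -/
theorem squarefree_dvd_of_eval_eq_zero_on_signChangeSet {H p : MvPolynomial (Fin (m + 1)) ℝ}
    (hH : Squarefree H)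
    (hind : ∀ a, Irreducible a → a ∣ H → (∃ x, 0 < eval x a) ∧ ∃ y, eval y a < 0)
    (hp : ∀ z ∈ signChangeSet (fun z => eval z H), eval z p = 0) : H ∣ p := by
  have hfac : ∀ a, Irreducible a → a ∣ H → a ∣ p := by
    rintro a ha ⟨h, rfl⟩
    obtain ⟨⟨x, hx⟩, y, hy⟩ := hind a ha (dvd_mul_right a h)
    refine dvd_of_eval_eq_zero_on_signChangeSet ha ?_ hx hy hp
    rintro ⟨g, rfl⟩
    exact ha.not_isUnit (hH a ⟨g, by ring⟩)
  clear hind hp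
  have key : ∀ K : MvPolynomial (Fin (m + 1)) ℝ, K ∣ H → K ∣ p := by
    intro K
    induction K using WfDvdMonoid.induction_on_irreducible with
    | zero => exact fun h0 => absurd (zero_dvd_iff.1 h0) hH.ne_zero
    | unit u hu => exact fun _ => hu.dvd
    | mul g a hg ha ih =>
      intro hd
      obtain ⟨q, rfl⟩ := ih ((dvd_mul_left g a).trans hd)
      have hag : ¬ a ∣ g := fun ⟨e, he⟩ =>
        ha.not_isUnit (hH a ((mul_dvd_mul_left a ⟨e, he⟩).trans hd))
      rcases ha.prime.dvd_or_dvd (hfac a ha ((dvd_mul_right a g).trans hd)) with h | ⟨e, rfl⟩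
      · exact absurd h hag
      · exact ⟨e, by ring⟩
  exact key H dvd_rfl

end MvPolynomial

theorem hasDerivAt_max_zero_pow (k : ℕ) (t : ℝ) :
    HasDerivAt (fun t : ℝ => max 0 t ^ (k + 2)) ((k + 2 : ℝ) * max 0 t ^ (k + 1)) t := by
  rcases lt_trichotomy t 0 with ht | rfl | ht
  · have h : (fun t : ℝ => max 0 t ^ (k + 2)) =ᶠ[nhds t] fun _ => 0 := by
      filter_upwards [gt_mem_nhds ht] with s hs
      simp [max_eq_left hs.le]
    rw [max_eq_left ht.le]
    simpa using (hasDerivAt_const t (0 : ℝ)).congr_of_eventuallyEq h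
  · rw [hasDerivAt_iff_isLittleO_nhds_zero]
    simp only [zero_add, max_self, ne_eq, Nat.add_eq_zero_iff, one_ne_zero, and_false,
      not_false_eq_true, zero_pow, mul_zero, smul_zero, sub_zero, OfNat.ofNat_ne_zero]
    have h1 : (fun h : ℝ => max 0 h ^ (k + 2)) =O[nhds 0] fun h : ℝ => h ^ (k + 2) := by
      refine Asymptotics.IsBigO.of_bound 1 (Filter.Eventually.of_forall fun h => ?_)
      rw [norm_pow, norm_pow, one_mul]
      gcongr
      rcases le_total 0 h with hh | hh <;> simp [hh]
    exact h1.trans_isLittleO (by simpa using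
      Asymptotics.isLittleO_pow_pow (𝕜 := ℝ) (show 1 < k + 2 by omega))
  · have h : (fun t : ℝ => max 0 t ^ (k + 2)) =ᶠ[nhds t] fun s => s ^ (k + 2) := by
      filter_upwards [lt_mem_nhds ht] with s hs
      rw [max_eq_right hs.le]
    rw [max_eq_right ht.le]
    simpa using (hasDerivAt_pow (k + 2) t).congr_of_eventuallyEq h

/-- The radial weight `(1 - |y|²)₊ᵏ⁺¹` supported in the Euclidean unit ball. -/
noncomputable def ballWeight {n : ℕ} (k : ℕ) (y : Fin n → ℝ) : ℝ :=
  max 0 (1 - ∑ i, y i ^ 2) ^ (k + 1)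

section ballWeight

variable {n : ℕ} {F : Type*} [NormedAddCommGroup F] [NormedSpace ℝ F]

theorem ballWeight_nonneg (k : ℕ) (y : Fin n → ℝ) : 0 ≤ ballWeight k y := by
  unfold ballWeight; positivity

theorem continuous_ballWeight (k : ℕ) : Continuous (ballWeight (n := n) k) := by
  unfold ballWeight; fun_prop

theorem ballWeight_zero_pos (k : ℕ) : 0 < ballWeight k (0 : Fin n → ℝ) := by
  simp [ballWeight]

theorem ballWeight_eq_zero (k : ℕ) {y : Fin n → ℝ} (hy : 1 ≤ ‖y‖) : ballWeight k y = 0 := by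
  have : ∃ i, 1 ≤ |y i| := by
    by_contra! h
    exact absurd hy (not_le.2 ((pi_norm_lt_iff one_pos).2 h))
  obtain ⟨i, hi⟩ := this
  have h2 : y i ^ 2 ≤ ∑ i, y i ^ 2 :=
    Finset.single_le_sum (f := fun i => y i ^ 2) (fun j _ => sq_nonneg (y j)) (Finset.mem_univ i)
  have h3 : 1 ≤ y i ^ 2 := by rw [← sq_abs]; nlinarith
  rw [ballWeight, max_eq_left (by linarith)]
  simp

theorem hasCompactSupport_ballWeight (k : ℕ) : HasCompactSupport (ballWeight (n := n) k) :=
  HasCompactSupport.intro (isCompact_closedBall 0 1) fun y hy => by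
    refine ballWeight_eq_zero k ?_
    simp at hy
    exact hy.le

theorem hasFDerivAt_ballWeight (k : ℕ) (y : Fin n → ℝ) :
    HasFDerivAt (ballWeight (k + 1))
      (∑ i, (-(2 * (k + 2) * y i * ballWeight k y)) • ContinuousLinearMap.proj (R := ℝ)
        (φ := fun _ : Fin n => ℝ) i) y := by
  have h1 : HasFDerivAt (fun y : Fin n → ℝ => 1 - ∑ i, y i ^ 2)
      (-∑ i, (2 * y i) • ContinuousLinearMap.proj (R := ℝ) (φ := fun _ : Fin n => ℝ) i) y := by
    refine HasFDerivAt.const_sub (c := (1 : ℝ)) ?_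
    refine HasFDerivAt.fun_sum fun i _ => ?_
    have := (hasFDerivAt_apply (𝕜 := ℝ) (F' := fun _ : Fin n => ℝ) i y).pow 2
    simpa using this
  have h2 := (hasDerivAt_max_zero_pow k (1 - ∑ i, y i ^ 2)).comp_hasFDerivAt y h1
  refine h2.congr_fderiv ?_
  rw [smul_neg, Finset.smul_sum, ← Finset.sum_neg_distrib]
  refine Finset.sum_congr rfl fun i _ => ?_
  rw [smul_smul, ← neg_smul]
  congr 1
  simp only [ballWeight]
  ring

theorem fderiv_ballWeight_single (k : ℕ) (y : Fin n → ℝ) (i : Fin n) :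
    fderiv ℝ (ballWeight (k + 1)) y (Pi.single i 1) = -(2 * (k + 2) * y i * ballWeight k y) := by
  rw [(hasFDerivAt_ballWeight k y).fderiv]
  simp [Pi.single_apply]

theorem integrable_ballWeight_smul (k : ℕ) {g : (Fin n → ℝ) → F} (hg : Continuous g) :
    Integrable fun y => ballWeight k y • g y :=
  ((continuous_ballWeight k).smul hg).integrable_of_hasCompactSupport
    (hasCompactSupport_ballWeight k).smul_right

theorem integral_ballWeight_smul_fderiv (k : ℕ) {f : (Fin n → ℝ) → F} (hf : ContDiff ℝ 1 f)
    (i : Fin n) :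
    ∫ y, ballWeight (k + 1) y • fderiv ℝ f y (Pi.single i 1) =
      (2 * (k + 2) : ℝ) • ∫ y, ballWeight k y • (y i • f y) := by
  have hf' : Continuous fun y => fderiv ℝ f y (Pi.single i 1) :=
    (hf.continuous_fderiv one_ne_zero).clm_apply continuous_const
  have key : ∀ y, fderiv ℝ (ballWeight (k + 1)) y (Pi.single i 1) • f y =
      -((2 * (k + 2) : ℝ) • (ballWeight k y • (y i • f y))) := fun y => by
    rw [fderiv_ballWeight_single, smul_smul, smul_smul, neg_smul]
    congr 2
    ring
  have hi := integrable_ballWeight_smul k ((continuous_apply i).smul hf.continuous)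
  rw [integral_smul_fderiv_eq_neg_fderiv_smul_of_integrable]
  · simp_rw [key]
    rw [integral_neg, neg_neg, integral_smul]
  · simp_rw [key]
    exact (hi.smul _).neg
  · exact integrable_ballWeight_smul _ hf'
  · exact integrable_ballWeight_smul _ hf.continuous
  · exact fun x _ => (hasFDerivAt_ballWeight k x).differentiableAt
  · exact fun x _ => hf.differentiable one_ne_zero x

theorem integral_ballWeight_pos (k : ℕ) : 0 < ∫ y : Fin n → ℝ, ballWeight k y :=
  (continuous_ballWeight k).integral_pos_of_hasCompactSupport_nonneg_nonzero
    (hasCompactSupport_ballWeight k) (ballWeight_nonneg k) (ballWeight_zero_pos k).ne'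

end ballWeight

theorem hasFDerivAt_setIntegral_of_isCompact {H X F : Type*} [NormedAddCommGroup H]
    [NormedSpace ℝ H] [ProperSpace H] [TopologicalSpace X] [T2Space X] [MeasurableSpace X]
    [BorelSpace X] [SecondCountableTopology X] [NormedAddCommGroup F] [NormedSpace ℝ F]
    {μ : Measure X} [IsFiniteMeasureOnCompacts μ] {K : Set X} (hK : IsCompact K)
    {U : Set H} (hU : IsOpen U) {p₀ : H} (hp₀ : p₀ ∈ U) {G : H → X → F} {G' : H → X → H →L[ℝ] F}
    (hG : ∀ p ∈ U, ContinuousOn (G p) K)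
    (hG' : ContinuousOn (Function.uncurry G') (U ×ˢ K))
    (hd : ∀ p ∈ U, ∀ y ∈ K, HasFDerivAt (fun p => G p y) (G' p y) p) :
    HasFDerivAt (fun p => ∫ y in K, G p y ∂μ) (∫ y in K, G' p₀ y ∂μ) p₀ := by
  obtain ⟨ε, hε, hεU⟩ := Metric.nhds_basis_closedBall.mem_iff.1 (hU.mem_nhds hp₀)
  obtain ⟨C, hC⟩ := ((isCompact_closedBall p₀ ε).prod hK).exists_bound_of_continuousOn
    (hG'.mono (Set.prod_mono hεU le_rfl))
  have hfin : IsFiniteMeasure (μ.restrict K) := ⟨by simpa using hK.measure_lt_top⟩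
  refine hasFDerivAt_integral_of_dominated_of_fderiv_le (bound := fun _ => C)
    (Metric.ball_mem_nhds p₀ hε) ?_ ?_ ?_ ?_ (integrable_const C) ?_
  · filter_upwards [hU.mem_nhds hp₀] with p hp
    exact (hG p hp).aestronglyMeasurable hK.measurableSet
  · exact (hG p₀ hp₀).integrableOn_compact hK
  · refine ContinuousOn.aestronglyMeasurable ?_ hK.measurableSet
    exact hG'.comp (f := fun y => (p₀, y)) (by fun_prop) fun y hy => ⟨hp₀, hy⟩
  · refine ae_restrict_of_forall_mem hK.measurableSet fun y hy p hp => ?_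
    exact hC (p, y) ⟨Metric.ball_subset_closedBall hp, hy⟩
  · refine ae_restrict_of_forall_mem hK.measurableSet fun y hy p hp => ?_
    exact hd p (hεU (Metric.ball_subset_closedBall hp)) y hy

section

variable {n : ℕ} {F : Type*} [NormedAddCommGroup F] [NormedSpace ℝ F]

theorem integral_ballWeight_eq_setIntegral (k : ℕ) (g : (Fin n → ℝ) → F) :
    ∫ y, ballWeight k y • g y = ∫ y in Metric.closedBall 0 1, ballWeight k y • g y := by
  symm
  refine setIntegral_eq_integral_of_forall_compl_eq_zero fun y hy => ?_
  rw [ballWeight_eq_zero k, zero_smul]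
  simp at hy
  exact hy.le

/-- The Laplacian with respect to the standard coordinates. -/
noncomputable def coordLaplacian (f : (Fin n → ℝ) → ℝ) (x : Fin n → ℝ) : ℝ :=
  ∑ i : Fin n, iteratedFDeriv ℝ 2 f x (fun _ => Pi.single i 1)

theorem hasDerivAt_integral_ballWeight (k : ℕ) {f : (Fin n → ℝ) → ℝ} (hf : ContDiff ℝ 2 f)
    (x : Fin n → ℝ) (r : ℝ) :
    HasDerivAt (fun r : ℝ => ∫ y, ballWeight k y • f (x + r • y))
      (r / (2 * (k + 2)) * ∫ y, ballWeight (k + 1) y • coordLaplacian f (x + r • y)) r := by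
  have hf1 : ContDiff ℝ 1 (fderiv ℝ f) := hf.fderiv_right (by norm_num)
  have hfd : ∀ z, HasFDerivAt f (fderiv ℝ f z) z := fun z =>
    (hf.differentiable two_ne_zero z).hasFDerivAt
  have hcont := hf.continuous
  have hcont' := hf1.continuous
  have hcw := continuous_ballWeight (n := n) k
  have h1 := hasFDerivAt_setIntegral_of_isCompact (μ := (volume : Measure (Fin n → ℝ)))
    (isCompact_closedBall (0 : Fin n → ℝ) 1) isOpen_univ (Set.mem_univ r)
    (G := fun (r : ℝ) y => ballWeight k y • f (x + r • y))
    (G' := fun (r : ℝ) y => ContinuousLinearMap.toSpanSingleton ℝ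
      (ballWeight k y • fderiv ℝ f (x + r • y) y))
    (fun r _ => by fun_prop)
    (by
      refine Continuous.continuousOn ?_
      refine (ContinuousLinearMap.toSpanSingletonLIE ℝ ℝ).continuous.comp ?_
      fun_prop)
    (fun r _ y _ => by
      have h2 : HasDerivAt (fun r : ℝ => x + r • y) y r := by
        simpa using ((hasDerivAt_id r).smul_const y).const_add x
      exact (((hfd (x + r • y)).comp_hasDerivAt r h2).const_smul (ballWeight k y)).hasFDerivAt)
  simp_rw [integral_ballWeight_eq_setIntegral k]
  refine h1.hasDerivAt.congr_deriv ?_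
  have hg : ∀ i, ContDiff ℝ 1 fun y : Fin n → ℝ => fderiv ℝ f (x + r • y) (Pi.single i 1) :=
    fun i => (hf1.comp (by fun_prop : ContDiff ℝ 1 fun y : Fin n → ℝ => x + r • y)).clm_apply
      contDiff_const
  have hgd : ∀ i (y : Fin n → ℝ), fderiv ℝ (fun y => fderiv ℝ f (x + r • y) (Pi.single i 1)) y
      (Pi.single i 1) = r * iteratedFDeriv ℝ 2 f (x + r • y) fun _ => Pi.single i 1 := by
    intro i y
    have h2 : HasFDerivAt (fun y : Fin n → ℝ => x + r • y)
        (r • ContinuousLinearMap.id ℝ (Fin n → ℝ)) y :=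
      ((hasFDerivAt_id y).const_smul r).const_add x
    have h3 := (((hf1.differentiable one_ne_zero (x + r • y)).hasFDerivAt.comp y h2).clm_apply
      (hasFDerivAt_const (Pi.single i (1 : ℝ)) y)).fderiv
    rw [Function.comp_def] at h3
    rw [h3, iteratedFDeriv_two_apply]
    simp
  have hgc : ∀ i, Continuous fun y : Fin n → ℝ =>
      ballWeight k y • (y i • fderiv ℝ f (x + r • y) (Pi.single i 1)) :=
    fun i => by fun_prop
  have expand : ∀ z y : Fin n → ℝ, fderiv ℝ f z y = ∑ i, y i • fderiv ℝ f z (Pi.single i 1) := by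
    intro z y
    conv_lhs => rw [pi_eq_sum_univ' y]
    rw [map_sum]
    simp_rw [map_smul]
  have hintg : IntegrableOn (fun y => ContinuousLinearMap.toSpanSingleton ℝ
      (ballWeight k y • fderiv ℝ f (x + r • y) y)) (Metric.closedBall 0 1) := by
    refine Continuous.continuousOn ?_ |>.integrableOn_compact (isCompact_closedBall _ _)
    exact (ContinuousLinearMap.toSpanSingletonLIE ℝ ℝ).continuous.comp (by fun_prop)
  rw [ContinuousLinearMap.integral_apply hintg]
  simp only [ContinuousLinearMap.toSpanSingleton_apply, one_smul]
  rw [← integral_ballWeight_eq_setIntegral k (fun y => fderiv ℝ f (x + r • y) y)]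
  have hsum : (fun y => ballWeight k y • fderiv ℝ f (x + r • y) y) = fun y =>
      ∑ i, ballWeight k y • (y i • fderiv ℝ f (x + r • y) (Pi.single i 1)) := by
    funext y
    rw [expand, Finset.smul_sum]
  rw [hsum]
  simp_rw [coordLaplacian, Finset.smul_sum]
  rw [integral_finsetSum, integral_finsetSum, Finset.mul_sum]
  · refine Finset.sum_congr rfl fun i _ => ?_
    have h4 := integral_ballWeight_smul_fderiv k (hg i) i
    simp_rw [hgd, smul_eq_mul, mul_left_comm _ r, integral_const_mul] at h4
    simp_rw [smul_eq_mul]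
    rw [div_mul_eq_mul_div, h4]
    field_simp
  · intro i _
    refine integrable_ballWeight_smul (k + 1) ?_
    have := hf.continuous_iteratedFDeriv (m := 2) le_rfl
    fun_prop
  · exact fun i _ => integrable_ballWeight_smul k (by fun_prop)

theorem integral_ballWeight_eq_of_coordLaplacian_eq_zero (k : ℕ) {f : (Fin n → ℝ) → ℝ}
    (hf : ContDiff ℝ 2 f) {x : Fin n → ℝ} {r : ℝ} (hr : 0 ≤ r)
    (h : ∀ z ∈ Metric.closedBall x r, coordLaplacian f z = 0) :
    ∫ y, ballWeight k y • f (x + r • y) = (∫ y : Fin n → ℝ, ballWeight k y) * f x := by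
  have key : ∀ s ∈ Set.Icc 0 r,
      HasDerivAt (fun r : ℝ => ∫ y, ballWeight k y • f (x + r • y)) 0 s := by
    intro s hs
    refine (hasDerivAt_integral_ballWeight k hf x s).congr_deriv ?_
    rw [integral_eq_zero_of_ae, mul_zero]
    refine Filter.Eventually.of_forall fun y => ?_
    rcases le_or_gt 1 ‖y‖ with hy | hy
    · simp [ballWeight_eq_zero _ hy]
    · have : coordLaplacian f (x + s • y) = 0 := by
        refine h _ ?_
        rw [mem_closedBall_iff_norm, add_sub_cancel_left, norm_smul, Real.norm_of_nonneg hs.1]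
        nlinarith [hs.1, hs.2, norm_nonneg y]
      simp [this]
  have h2 := constant_of_has_deriv_right_zero
    (f := fun r : ℝ => ∫ y, ballWeight k y • f (x + r • y)) (a := 0) (b := r)
    (fun s hs => (key s hs).continuousAt.continuousWithinAt)
    (fun s hs => (key s ⟨hs.1, hs.2.le⟩).hasDerivWithinAt) r ⟨hr, le_rfl⟩
  simp only [zero_smul, add_zero] at h2
  rw [h2, integral_smul_const, smul_eq_mul]

end

theorem exists_contDiff_eventuallyEq_closedBall {E : Type*} [NormedAddCommGroup E]
    [NormedSpace ℝ E] [FiniteDimensional ℝ E] {v : E → ℝ} {Ω : Set E} (hΩ : IsOpen Ω) {N : ℕ}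
    (hv : ContDiffOn ℝ N v Ω) {x : E} {r : ℝ} (hr : 0 < r) (h : Metric.closedBall x r ⊆ Ω) :
    ∃ f : E → ℝ, ContDiff ℝ N f ∧ ∀ z ∈ Metric.closedBall x r, f =ᶠ[nhds z] v := by
  obtain ⟨δ, hδ, hsub⟩ := (isCompact_closedBall x r).exists_cthickening_subset_open hΩ h
  rw [cthickening_closedBall hδ.le hr.le] at hsub
  let χ : ContDiffBump x := ⟨r + δ / 3, r + 2 * δ / 3, by positivity, by linarith⟩
  refine ⟨fun z => χ z * v z, ?_, fun z hz => ?_⟩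
  · rw [contDiff_iff_contDiffAt]
    intro z
    by_cases hz : z ∈ tsupport χ
    · have hzΩ : z ∈ Ω := by
        rw [χ.tsupport_eq] at hz
        refine hsub (Metric.closedBall_subset_closedBall ?_ hz)
        change r + 2 * δ / 3 ≤ δ + r
        linarith
      exact χ.contDiff.contDiffAt.mul (hv.contDiffAt (hΩ.mem_nhds hzΩ))
    · have h0 : (fun z => χ z * v z) =ᶠ[nhds z] fun _ => 0 := by
        filter_upwards [notMem_tsupport_iff_eventuallyEq.1 hz] with a ha
        simp [ha]
      exact contDiffAt_const.congr_of_eventuallyEq h0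
  · have hz2 : z ∈ Metric.ball x (r + δ / 3) := by
      rw [Metric.mem_closedBall] at hz
      rw [Metric.mem_ball]
      linarith
    filter_upwards [χ.eventuallyEq_one_of_mem_ball hz2] with a ha
    simp [ha]

section

variable {n : ℕ} {F : Type*} [NormedAddCommGroup F] [NormedSpace ℝ F]

/-- The weighted mean value property on all closed balls contained in `B`. -/
def HasWeightedMean (g : (Fin n → ℝ) → F) (B : Set (Fin n → ℝ)) : Prop :=
  ∀ x r, 0 < r → Metric.closedBall x r ⊆ B →
    ∫ y, ballWeight 1 y • g (x + r • y) = (∫ y : Fin n → ℝ, ballWeight 1 y) • g x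

theorem hasWeightedMean_of_coordLaplacian_eq_zero {v : (Fin n → ℝ) → ℝ} {Ω : Set (Fin n → ℝ)}
    (hΩ : IsOpen Ω) (hv : ContDiffOn ℝ 2 v Ω) (h : ∀ x ∈ Ω, coordLaplacian v x = 0) :
    HasWeightedMean v Ω := by
  intro x r hr hsub
  obtain ⟨f, hf, hfv⟩ := exists_contDiff_eventuallyEq_closedBall (N := 2) hΩ hv hr hsub
  have h1 := integral_ballWeight_eq_of_coordLaplacian_eq_zero 1 hf hr.le fun z hz => by
    rw [← h z (hsub hz)]
    simp only [coordLaplacian]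
    rw [Filter.EventuallyEq.eq_of_nhds (Filter.EventuallyEq.iteratedFDeriv ℝ (hfv z hz) 2)]
  rw [smul_eq_mul, ← (hfv x (Metric.mem_closedBall_self hr.le)).self_of_nhds, ← h1]
  congr 1
  funext y
  rcases le_or_gt 1 ‖y‖ with hy | hy
  · simp [ballWeight_eq_zero _ hy]
  · have hmem : x + r • y ∈ Metric.closedBall x r := by
      rw [mem_closedBall_iff_norm, add_sub_cancel_left, norm_smul, Real.norm_of_nonneg hr.le]
      nlinarith
    rw [(hfv _ hmem).self_of_nhds]

theorem add_smul_mem_closedBall {x y : Fin n → ℝ} {r : ℝ} (hr : 0 ≤ r)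
    (hy : y ∈ Metric.closedBall 0 1) : x + r • y ∈ Metric.closedBall x r := by
  rw [mem_closedBall_iff_norm, add_sub_cancel_left, norm_smul, Real.norm_of_nonneg hr]
  rw [mem_closedBall_zero_iff] at hy
  nlinarith

theorem HasWeightedMean.clm_comp [CompleteSpace F] {F' : Type*} [NormedAddCommGroup F']
    [NormedSpace ℝ F'] [CompleteSpace F'] {g : (Fin n → ℝ) → F} {B : Set (Fin n → ℝ)} (hg : HasWeightedMean g B)
    (hc : ContinuousOn g B) (L : F →L[ℝ] F') : HasWeightedMean (fun x => L (g x)) B := by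
  intro x r hr hsub
  have := congrArg L (hg x r hr hsub)
  rw [map_smul, integral_ballWeight_eq_setIntegral, ← ContinuousLinearMap.integral_comp_comm] at this
  · rw [← this, integral_ballWeight_eq_setIntegral]
    simp_rw [map_smul]
  · refine ContinuousOn.integrableOn_compact (isCompact_closedBall _ _) ?_
    exact (continuous_ballWeight 1).continuousOn.smul (hc.comp
      (f := fun y => x + r • y) (by fun_prop) fun y hy => hsub (add_smul_mem_closedBall hr.le hy))

theorem HasWeightedMean.mean_fderiv [CompleteSpace F] {g : (Fin n → ℝ) → F} {B : Set (Fin n → ℝ)}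
    (hB : IsOpen B) (hg : HasWeightedMean g B) (hd : DifferentiableOn ℝ g B)
    (hc : ContinuousOn (fderiv ℝ g) B) : HasWeightedMean (fderiv ℝ g) B := by
  intro x r hr hsub
  obtain ⟨δ, hδ, hsub'⟩ := (isCompact_closedBall x r).exists_cthickening_subset_open hB hsub
  rw [cthickening_closedBall hδ.le hr.le] at hsub'
  have hmem : ∀ p ∈ Metric.ball x δ, ∀ y ∈ Metric.closedBall (0 : Fin n → ℝ) 1, p + r • y ∈ B := by
    intro p hp y hy
    refine hsub' (Metric.closedBall_subset_closedBall' ?_ (add_smul_mem_closedBall hr.le hy))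
    rw [Metric.mem_ball] at hp
    linarith
  have h1 := hasFDerivAt_setIntegral_of_isCompact (μ := (volume : Measure (Fin n → ℝ)))
    (isCompact_closedBall (0 : Fin n → ℝ) 1) Metric.isOpen_ball (Metric.mem_ball_self hδ (x := x))
    (G := fun p y => ballWeight 1 y • g (p + r • y))
    (G' := fun p y => ballWeight 1 y • fderiv ℝ g (p + r • y))
    (fun p hp => (continuous_ballWeight 1).continuousOn.smul
      (hd.continuousOn.comp (by fun_prop) fun y hy => hmem p hp y hy))
    (((continuous_ballWeight 1).comp continuous_snd).continuousOn.smul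
      (hc.comp (f := fun q : (Fin n → ℝ) × (Fin n → ℝ) => q.1 + r • q.2) (by fun_prop)
        fun q hq => hmem q.1 hq.1 q.2 hq.2))
    (fun p hp y hy => by
      have h2 : HasFDerivAt (fun p : Fin n → ℝ => p + r • y)
        (ContinuousLinearMap.id ℝ (Fin n → ℝ)) p := (hasFDerivAt_id p).add_const _
      have h3 := (hd.differentiableAt (hB.mem_nhds (hmem p hp y hy))).hasFDerivAt.comp p h2
      rw [ContinuousLinearMap.comp_id] at h3
      exact h3.const_smul (ballWeight 1 y))
  rw [← integral_ballWeight_eq_setIntegral 1 fun y => fderiv ℝ g (x + r • y)] at h1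
  have h4 : (fun p => ∫ y in Metric.closedBall 0 1, ballWeight 1 y • g (p + r • y)) =ᶠ[nhds x]
      fun p => (∫ y : Fin n → ℝ, ballWeight 1 y) • g p := by
    filter_upwards [Metric.ball_mem_nhds x hδ] with p hp
    rw [← integral_ballWeight_eq_setIntegral 1 fun y => g (p + r • y), hg p r hr]
    refine (Metric.closedBall_subset_closedBall' ?_).trans hsub'
    rw [Metric.mem_ball] at hp
    linarith
  have h5 := (hd.differentiableAt (hB.mem_nhds (hsub
    (Metric.mem_closedBall_self hr.le)))).hasFDerivAt.const_smul (∫ y : Fin n → ℝ, ballWeight 1 y)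
  exact (h1.congr_of_eventuallyEq h4.symm).unique h5

end

theorem continuousOn_setIntegral_of_isCompact {H X F : Type*} [NormedAddCommGroup H]
    [ProperSpace H] [TopologicalSpace X] [T2Space X] [MeasurableSpace X]
    [BorelSpace X] [SecondCountableTopology X] [NormedAddCommGroup F] [NormedSpace ℝ F]
    {μ : Measure X} [IsFiniteMeasureOnCompacts μ] {K : Set X} (hK : IsCompact K)
    {U : Set H} (hU : IsOpen U) {G : H → X → F}
    (hG : ContinuousOn (Function.uncurry G) (U ×ˢ K)) :
    ContinuousOn (fun p => ∫ y in K, G p y ∂μ) U := by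
  intro p₀ hp₀
  refine ContinuousAt.continuousWithinAt ?_
  obtain ⟨ε, hε, hεU⟩ := Metric.nhds_basis_closedBall.mem_iff.1 (hU.mem_nhds hp₀)
  obtain ⟨C, hC⟩ := ((isCompact_closedBall p₀ ε).prod hK).exists_bound_of_continuousOn
    (hG.mono (Set.prod_mono hεU le_rfl))
  have hfin : IsFiniteMeasure (μ.restrict K) := ⟨by simpa using hK.measure_lt_top⟩
  refine continuousAt_of_dominated (bound := fun _ => C) ?_ ?_ (integrable_const C) ?_
  · filter_upwards [hU.mem_nhds hp₀] with p hp
    refine ContinuousOn.aestronglyMeasurable ?_ hK.measurableSet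
    exact hG.comp (f := fun y => (p, y)) (by fun_prop) fun y hy => ⟨hp, hy⟩
  · filter_upwards [Metric.closedBall_mem_nhds p₀ hε] with p hp
    exact ae_restrict_of_forall_mem hK.measurableSet fun y hy => hC (p, y) ⟨hp, hy⟩
  · refine ae_restrict_of_forall_mem hK.measurableSet fun y hy => ?_
    exact (hG.comp (f := fun p => (p, y)) (by fun_prop) fun p hp => ⟨hp, hy⟩).continuousAt
      (hU.mem_nhds hp₀)

section

variable {n : ℕ} {F : Type*} [NormedAddCommGroup F] [NormedSpace ℝ F]

theorem continuous_fderiv_ballWeight (k : ℕ) :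
    Continuous (fderiv ℝ (ballWeight (n := n) (k + 1))) := by
  have : fderiv ℝ (ballWeight (n := n) (k + 1)) = fun y =>
      (∑ i, (-(2 * (k + 2) * y i * ballWeight k y)) • ContinuousLinearMap.proj (R := ℝ)
        (φ := fun _ : Fin n => ℝ) i) := funext fun y => (hasFDerivAt_ballWeight k y).fderiv
  rw [this]
  have := continuous_ballWeight (n := n) k
  fun_prop

theorem fderiv_ballWeight_eq_zero (k : ℕ) {y : Fin n → ℝ} (hy : 1 ≤ ‖y‖) :
    fderiv ℝ (ballWeight (k + 1)) y = 0 := by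
  rw [(hasFDerivAt_ballWeight k y).fderiv]
  simp [ballWeight_eq_zero k hy]

theorem integral_comp_add_smul (Φ : (Fin n → ℝ) → F) (x : Fin n → ℝ) {r : ℝ} (hr : 0 ≤ r) :
    ∫ y, Φ (x + r • y) = (r ^ n)⁻¹ • ∫ z, Φ z := by
  rw [Measure.integral_comp_smul_of_nonneg volume (fun y => Φ (x + y)) r (hR := hr),
    integral_add_left_eq_self]
  simp

variable (n) in
/-- The constant of the gradient estimate for functions with the weighted mean value property. -/
noncomputable def gradientConst : ℝ :=
  (∫ y : Fin n → ℝ, ballWeight 1 y)⁻¹ * ∫ y : Fin n → ℝ, ‖fderiv ℝ (ballWeight 1) y‖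

theorem gradientConst_nonneg : 0 ≤ gradientConst n := by
  have := (integral_ballWeight_pos (n := n) 1).le
  unfold gradientConst
  positivity

theorem HasWeightedMean.exists_hasFDerivAt [CompleteSpace F] {g : (Fin n → ℝ) → F}
    {B : Set (Fin n → ℝ)} (hB : IsOpen B) (hg : HasWeightedMean g B) (hc : ContinuousOn g B)
    {x₀ : Fin n → ℝ} {r : ℝ} (hr : 0 < r) (hsub : Metric.closedBall x₀ r ⊆ B) :
    ∃ δ > 0, ∃ D : (Fin n → ℝ) → (Fin n → ℝ) →L[ℝ] F, ContinuousOn D (Metric.ball x₀ δ) ∧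
      (∀ x ∈ Metric.ball x₀ δ, HasFDerivAt g (D x) x) ∧
      ∀ M, (∀ z ∈ Metric.closedBall x₀ r, ‖g z‖ ≤ M) → ‖D x₀‖ ≤ gradientConst n / r * M := by
  obtain ⟨δ, hδ, hsub'⟩ := (isCompact_closedBall x₀ r).exists_cthickening_subset_open hB hsub
  rw [cthickening_closedBall hδ.le hr.le] at hsub'
  set K := Metric.closedBall x₀ (δ + r) with hKdef
  have hK : IsCompact K := isCompact_closedBall _ _
  set c := ∫ y : Fin n → ℝ, ballWeight 1 y with hcdef
  have hcpos : 0 < c := integral_ballWeight_pos 1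
  let G : (Fin n → ℝ) → (Fin n → ℝ) → F := fun x z => ballWeight 1 (r⁻¹ • (z - x)) • g z
  let G' : (Fin n → ℝ) → (Fin n → ℝ) → (Fin n → ℝ) →L[ℝ] F := fun x z =>
    (-(r⁻¹ • fderiv ℝ (ballWeight 1) (r⁻¹ • (z - x)))).smulRight (g z)
  have hgK : ContinuousOn g K := hc.mono hsub'
  have hGc : ∀ p ∈ Metric.ball x₀ δ, ContinuousOn (G p) K := fun p _ =>
    ((continuous_ballWeight 1).comp (by fun_prop)).continuousOn.smul hgK
  have hG'c : ContinuousOn (Function.uncurry G') (Metric.ball x₀ δ ×ˢ K) := by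
    have h1 : Continuous fun q : (Fin n → ℝ) × (Fin n → ℝ) =>
        -(r⁻¹ • fderiv ℝ (ballWeight 1) (r⁻¹ • (q.2 - q.1))) :=
      (((continuous_fderiv_ballWeight 0).comp
        (g := fderiv ℝ (ballWeight 1)) (f := fun q : (Fin n → ℝ) × (Fin n → ℝ) =>
          r⁻¹ • (q.2 - q.1)) (by fun_prop)).const_smul r⁻¹).neg
    have h2 : ContinuousOn (fun q : (Fin n → ℝ) × (Fin n → ℝ) => g q.2)
        (Metric.ball x₀ δ ×ˢ K) := hgK.comp continuousOn_snd fun q hq => hq.2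
    exact ((ContinuousLinearMap.smulRightL ℝ (Fin n → ℝ) F).continuous.comp_continuousOn
      h1.continuousOn).clm_apply h2
  have hd : ∀ p ∈ Metric.ball x₀ δ, ∀ z ∈ K, HasFDerivAt (fun p => G p z) (G' p z) p := by
    intro p _ z _
    have h1 : HasFDerivAt (fun p : Fin n → ℝ => r⁻¹ • (z - p))
        (r⁻¹ • -ContinuousLinearMap.id ℝ (Fin n → ℝ)) p :=
      ((hasFDerivAt_id p).const_sub z).const_smul r⁻¹
    have h2 := ((hasFDerivAt_ballWeight 0 (r⁻¹ • (z - p))).differentiableAt.hasFDerivAt.comp p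
      h1).smul_const (g z)
    refine h2.congr_fderiv ?_
    simp only [G']
    congr 1
    ext e
    simp
  have hrep : ∀ p ∈ Metric.ball x₀ δ, g p = c⁻¹ • (r ^ n)⁻¹ • ∫ z in K, G p z := by
    intro p hp
    rw [Metric.mem_ball] at hp
    have h1 := hg p r hr ((Metric.closedBall_subset_closedBall' (by linarith)).trans hsub')
    rw [← hcdef] at h1
    have h2 : ∫ z in K, G p z = ∫ z, G p z := by
      refine setIntegral_eq_integral_of_forall_compl_eq_zero fun z hz => ?_
      simp only [G]
      rw [ballWeight_eq_zero, zero_smul]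
      rw [norm_smul, norm_inv, Real.norm_of_nonneg hr.le, ← dist_eq_norm]
      rw [hKdef, Metric.mem_closedBall, not_le] at hz
      have := dist_triangle z p x₀
      rw [← div_eq_inv_mul, one_le_div hr]
      linarith
    rw [h2, ← integral_comp_add_smul (G p) p hr.le]
    have h3 : ∀ y, G p (p + r • y) = ballWeight 1 y • g (p + r • y) := fun y => by
      simp only [G]
      rw [add_sub_cancel_left, smul_smul, inv_mul_cancel₀ hr.ne', one_smul]
    simp_rw [h3]
    rw [h1, smul_smul, inv_mul_cancel₀ hcpos.ne', one_smul]
  refine ⟨δ, hδ, fun p => c⁻¹ • (r ^ n)⁻¹ • ∫ z in K, G' p z, ?_, fun p hp => ?_, fun M hM => ?_⟩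
  · exact ((continuousOn_setIntegral_of_isCompact (μ := volume) hK Metric.isOpen_ball
      hG'c).const_smul (r ^ n)⁻¹).const_smul c⁻¹
  · have h1 := ((hasFDerivAt_setIntegral_of_isCompact (μ := volume) hK Metric.isOpen_ball hp hGc
      hG'c hd).const_smul (r ^ n)⁻¹).const_smul c⁻¹
    refine h1.congr_of_eventuallyEq ?_
    filter_upwards [Metric.isOpen_ball.mem_nhds hp] with q hq
    exact hrep q hq
  · have hM0 : 0 ≤ M := (norm_nonneg _).trans (hM x₀ (Metric.mem_closedBall_self hr.le))
    let Ψ : (Fin n → ℝ) → ℝ := fun z =>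
      ‖fderiv ℝ (ballWeight (n := n) 1) (r⁻¹ • (z - x₀))‖ * (r⁻¹ * M)
    have hΨz : ∀ z, r ≤ ‖z - x₀‖ → fderiv ℝ (ballWeight (n := n) 1) (r⁻¹ • (z - x₀)) = 0 := by
      intro z hz
      apply fderiv_ballWeight_eq_zero 0
      rw [norm_smul, norm_inv, Real.norm_of_nonneg hr.le, ← div_eq_inv_mul, one_le_div hr]
      exact hz
    have hΨc : Continuous Ψ :=
      ((continuous_fderiv_ballWeight 0).comp (by fun_prop)).norm.mul continuous_const
    have hb : ∀ z ∈ K, ‖G' x₀ z‖ ≤ Ψ z := by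
      intro z hz
      rcases le_or_gt r ‖z - x₀‖ with h | h
      · simp [G', Ψ, hΨz z h]
      · have := hM z (by rw [mem_closedBall_iff_norm]; exact h.le)
        simp only [G', Ψ, ContinuousLinearMap.norm_smulRight_apply, norm_neg, norm_smul, norm_inv,
          Real.norm_of_nonneg hr.le]
        calc _ = ‖fderiv ℝ (ballWeight (n := n) 1) (r⁻¹ • (z - x₀))‖ * (r⁻¹ * ‖g z‖) := by ring
          _ ≤ _ := by gcongr
    have h1 : ‖∫ z in K, G' x₀ z‖ ≤ ∫ z in K, Ψ z :=
      norm_integral_le_of_norm_le (hΨc.continuousOn.integrableOn_compact hK)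
        (ae_restrict_of_forall_mem hK.measurableSet hb)
    have h2 : ∫ z in K, Ψ z = ∫ z, Ψ z := by
      refine setIntegral_eq_integral_of_forall_compl_eq_zero fun z hz => ?_
      rw [hKdef, mem_closedBall_iff_norm, not_le] at hz
      simp [Ψ, hΨz z (by linarith)]
    have h3 := integral_comp_add_smul Ψ x₀ hr.le
    have h4 : ∀ y, Ψ (x₀ + r • y) = ‖fderiv ℝ (ballWeight (n := n) 1) y‖ * (r⁻¹ * M) := fun y => by
      simp only [Ψ]
      rw [add_sub_cancel_left, smul_smul, inv_mul_cancel₀ hr.ne', one_smul]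
    simp_rw [h4] at h3
    rw [integral_mul_const] at h3
    rw [norm_smul, norm_smul, norm_inv, norm_inv, Real.norm_of_nonneg hcpos.le,
      Real.norm_of_nonneg (pow_pos hr n).le]
    calc c⁻¹ * ((r ^ n)⁻¹ * ‖∫ z in K, G' x₀ z‖) ≤ c⁻¹ * ((r ^ n)⁻¹ * ∫ z, Ψ z) := by
          rw [← h2]; gcongr
      _ = gradientConst n / r * M := by
          rw [← smul_eq_mul (r ^ n)⁻¹, ← h3, gradientConst, ← hcdef]
          field_simp

theorem HasWeightedMean.differentiableOn [CompleteSpace F] {g : (Fin n → ℝ) → F}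
    {B : Set (Fin n → ℝ)} (hB : IsOpen B) (hg : HasWeightedMean g B) (hc : ContinuousOn g B) :
    DifferentiableOn ℝ g B ∧ ContinuousOn (fderiv ℝ g) B := by
  refine ⟨fun x hx => ?_, fun x hx => ?_⟩ <;>
    obtain ⟨r, hr, hsub⟩ := Metric.nhds_basis_closedBall.mem_iff.1 (hB.mem_nhds hx) <;>
    obtain ⟨δ, hδ, D, hD, hd, -⟩ := hg.exists_hasFDerivAt hB hc hr hsub
  · exact (hd x (Metric.mem_ball_self hδ)).differentiableAt.differentiableWithinAt
  · have h1 : fderiv ℝ g =ᶠ[nhds x] D := by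
      filter_upwards [Metric.ball_mem_nhds x hδ] with y hy
      exact (hd y hy).fderiv
    exact ((hD.continuousAt (Metric.ball_mem_nhds x hδ)).congr h1.symm).continuousWithinAt

theorem HasWeightedMean.norm_fderiv_le [CompleteSpace F] {g : (Fin n → ℝ) → F}
    {B : Set (Fin n → ℝ)} (hB : IsOpen B) (hg : HasWeightedMean g B) (hc : ContinuousOn g B)
    {x : Fin n → ℝ} {r M : ℝ} (hr : 0 < r) (hsub : Metric.closedBall x r ⊆ B)
    (hM : ∀ z ∈ Metric.closedBall x r, ‖g z‖ ≤ M) :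
    ‖fderiv ℝ g x‖ ≤ gradientConst n / r * M := by
  obtain ⟨δ, hδ, D, hD, hd, h⟩ := hg.exists_hasFDerivAt hB hc hr hsub
  rw [(hd x (Metric.mem_ball_self hδ)).fderiv]
  exact h M hM

end

open scoped Nat in
theorem analyticAt_of_norm_iteratedFDeriv_le {E F : Type*} [NormedAddCommGroup E]
    [NormedSpace ℝ E] [NormedAddCommGroup F] [NormedSpace ℝ F] [CompleteSpace F] {f : E → F}
    {x₀ : E} {R M A : ℝ} (hR : 0 < R) (hA : 0 < A)
    (hf : ∀ x ∈ Metric.ball x₀ R, ∀ j : ℕ, ContDiffAt ℝ j f x)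
    (hb : ∀ x ∈ Metric.ball x₀ R, ∀ j : ℕ, ‖iteratedFDeriv ℝ j f x‖ ≤ M * A ^ j * j !) :
    AnalyticAt ℝ f x₀ := by
  have hM : 0 ≤ M := by
    simpa using (norm_nonneg _).trans (hb x₀ (Metric.mem_ball_self hR) 0)
  obtain ⟨ρ, hρ, hρR, hρA⟩ : ∃ ρ : NNReal, 0 < ρ ∧ (ρ : ℝ) ≤ R ∧ A * ρ ≤ 1 / 2 := by
    have h0 : 0 < min R (1 / (2 * A)) := lt_min hR (by positivity)
    refine ⟨(min R (1 / (2 * A))).toNNReal, by simpa using h0, ?_, ?_⟩ <;>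
      rw [Real.coe_toNNReal _ h0.le]
    · exact min_le_left _ _
    · calc A * min R (1 / (2 * A)) ≤ A * (1 / (2 * A)) := by gcongr; exact min_le_right _ _
        _ = 1 / 2 := by field_simp
  let p : FormalMultilinearSeries ℝ E F := fun j => (j ! : ℝ)⁻¹ • iteratedFDeriv ℝ j f x₀
  have hp : ∀ j, ‖p j‖ ≤ M * A ^ j := by
    intro j
    have h1 := hb x₀ (Metric.mem_ball_self hR) j
    have h2 : (0 : ℝ) < j ! := by exact_mod_cast j.factorial_pos
    simp only [p, norm_smul, norm_inv, Real.norm_of_nonneg h2.le]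
    rw [inv_mul_le_iff₀ h2]
    linarith
  have hpow : ∀ (j : ℕ) (s : ℝ), 0 ≤ s → s ≤ ρ → M * A ^ j * s ^ j ≤ M * (1 / 2) ^ j := by
    intro j s hs hsρ
    rw [mul_assoc, ← mul_pow]
    gcongr
    exact (mul_le_mul_of_nonneg_left hsρ hA.le).trans hρA
  refine ⟨p, ρ, ?_, by exact_mod_cast hρ, fun {y} hy => ?_⟩
  · refine p.le_radius_of_bound M fun j => ?_
    calc ‖p j‖ * (ρ : ℝ) ^ j ≤ M * A ^ j * ρ ^ j := by gcongr; exact hp j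
      _ ≤ M * (1 / 2) ^ j := hpow j ρ ρ.2 le_rfl
      _ ≤ M := mul_le_of_le_one_right hM (pow_le_one₀ (by norm_num) (by norm_num))
  · have hy' : ‖y‖ < ρ := by simpa using hy
    have hgeo := summable_geometric_of_lt_one (r := (1 / 2 : ℝ)) (by norm_num) (by norm_num)
    have hs : Summable fun j => ‖p j fun _ => y‖ := by
      refine Summable.of_nonneg_of_le (fun _ => norm_nonneg _) (fun j => ?_) (hgeo.mul_left M)
      calc ‖p j fun _ => y‖ ≤ ‖p j‖ * ‖y‖ ^ j := by
            simpa using (p j).le_opNorm fun _ => y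
        _ ≤ M * A ^ j * ‖y‖ ^ j := by gcongr; exact hp j
        _ ≤ _ := hpow j _ (norm_nonneg _) hy'.le
    rw [hasSum_iff_tendsto_nat_of_summable_norm hs, ← Filter.tendsto_add_atTop_iff_nat 1]
    have hmem : ∀ t ∈ Set.Icc (0 : ℝ) 1, x₀ + t • y ∈ Metric.ball x₀ R := by
      intro t ht
      rw [mem_ball_iff_norm, add_sub_cancel_left, norm_smul, Real.norm_of_nonneg ht.1]
      nlinarith [norm_nonneg y, ht.2]
    have hrem : ∀ j : ℕ, ‖f (x₀ + y) - ∑ k ∈ Finset.range (j + 1), p k fun _ => y‖ ≤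
        M * ((j + 1 : ℕ) * (1 / 2) ^ (j + 1)) := by
      intro j
      have h1 := map_add_eq_sum_add_integral_iteratedFDeriv (n := j) (f := f) (x := x₀) (y := y)
        fun t ht => by exact_mod_cast hf _ (hmem t ht) (j + 1)
      have h2 : (0 : ℝ) < j ! := by exact_mod_cast j.factorial_pos
      rw [h1]
      simp only [p, smul_apply, add_sub_cancel_left]
      rw [norm_smul, norm_inv, Real.norm_of_nonneg h2.le, inv_mul_le_iff₀ h2]
      have h3 := intervalIntegral.norm_integral_le_of_norm_le_const (a := 0) (b := 1)
        (C := M * (1 / 2) ^ (j + 1) * (j + 1)!)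
        (f := fun t => (1 - t) ^ j • iteratedFDeriv ℝ (j + 1) f (x₀ + t • y) fun _ => y)
        fun t ht => by
          rw [Set.uIoc_of_le zero_le_one] at ht
          have ht' : t ∈ Set.Icc (0 : ℝ) 1 := ⟨ht.1.le, ht.2⟩
          have h4 := (iteratedFDeriv ℝ (j + 1) f (x₀ + t • y)).le_opNorm fun _ => y
          have h5 := hb _ (hmem t ht') (j + 1)
          have h6 := hpow (j + 1) ‖y‖ (norm_nonneg _) hy'.le
          have h7 : ‖(1 - t) ^ j‖ ≤ 1 := by
            rw [norm_pow, Real.norm_of_nonneg (by linarith [ht.2])]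
            exact pow_le_one₀ (by linarith [ht.2]) (by linarith [ht.1])
          simp only [Finset.prod_const, Finset.card_univ, Fintype.card_fin] at h4
          rw [norm_smul]
          calc _ ≤ 1 * (‖iteratedFDeriv ℝ (j + 1) f (x₀ + t • y)‖ * ‖y‖ ^ (j + 1)) := by gcongr
            _ ≤ 1 * (M * A ^ (j + 1) * (j + 1)! * ‖y‖ ^ (j + 1)) := by gcongr
            _ = (M * A ^ (j + 1) * ‖y‖ ^ (j + 1)) * (j + 1)! := by ring
            _ ≤ _ := by gcongr
      refine h3.trans (le_of_eq ?_)
      rw [Nat.factorial_succ]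
      push_cast
      simp
      ring
    rw [tendsto_iff_norm_sub_tendsto_zero]
    have h0 : Filter.Tendsto (fun j : ℕ => M * ((j + 1 : ℕ) * (1 / 2 : ℝ) ^ (j + 1)))
        Filter.atTop (nhds 0) := by
      have := (tendsto_self_mul_const_pow_of_lt_one (r := (1 / 2 : ℝ)) (by norm_num)
        (by norm_num)).const_mul M
      rw [mul_zero] at this
      exact (Filter.tendsto_add_atTop_iff_nat
        (f := fun j : ℕ => M * ((j : ℝ) * (1 / 2 : ℝ) ^ j)) 1).2 this
    refine squeeze_zero (fun _ => norm_nonneg _) (fun j => ?_) h0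
    rw [norm_sub_rev]
    exact hrem j

section

variable {n : ℕ} {F : Type*} [NormedAddCommGroup F] [NormedSpace ℝ F] [CompleteSpace F]
  {g : (Fin n → ℝ) → F} {B : Set (Fin n → ℝ)}

theorem HasWeightedMean.mean_iteratedFDeriv (hB : IsOpen B) (hg : HasWeightedMean g B)
    (hc : ContinuousOn g B) (j : ℕ) : HasWeightedMean (iteratedFDeriv ℝ j g) B ∧
      ContinuousOn (iteratedFDeriv ℝ j g) B := by
  induction j with
  | zero =>
    rw [iteratedFDeriv_zero_eq_comp]
    let L := (continuousMultilinearCurryFin0 ℝ (Fin n → ℝ) F).symm.toContinuousLinearEquiv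
      |>.toContinuousLinearMap
    exact ⟨hg.clm_comp hc L, L.continuous.comp_continuousOn hc⟩
  | succ j ih =>
    obtain ⟨hd, hdc⟩ := ih.1.differentiableOn hB ih.2
    rw [iteratedFDeriv_succ_eq_comp_left]
    let L := (continuousMultilinearCurryLeftEquiv ℝ (fun _ : Fin (j + 1) =>
      Fin n → ℝ) F).symm.toContinuousLinearEquiv.toContinuousLinearMap
    exact ⟨(ih.1.mean_fderiv hB hd hdc).clm_comp hdc L, L.continuous.comp_continuousOn hdc⟩

theorem HasWeightedMean.norm_iteratedFDeriv_le (hB : IsOpen B) (hg : HasWeightedMean g B)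
    (hc : ContinuousOn g B) {δ M : ℝ} (hδ : 0 < δ) (j : ℕ) (x : Fin n → ℝ)
    (hsub : Metric.closedBall x (j * δ) ⊆ B)
    (hM : ∀ z ∈ Metric.closedBall x (j * δ), ‖g z‖ ≤ M) :
    ‖iteratedFDeriv ℝ j g x‖ ≤ (gradientConst n / δ) ^ j * M := by
  induction j generalizing x with
  | zero => simpa using hM x (by simp)
  | succ j ih =>
    rw [← norm_fderiv_iteratedFDeriv]
    obtain ⟨hm, hmc⟩ := hg.mean_iteratedFDeriv hB hc j
    have hincl : ∀ z ∈ Metric.closedBall x δ,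
        Metric.closedBall z (j * δ) ⊆ Metric.closedBall x ((j + 1 : ℕ) * δ) := by
      intro z hz
      refine Metric.closedBall_subset_closedBall' ?_
      rw [Metric.mem_closedBall] at hz
      push_cast
      linarith
    refine (hm.norm_fderiv_le hB hmc hδ ?_ fun z hz => ih z ((hincl z hz).trans hsub)
      fun w hw => hM w (hincl z hz hw)).trans_eq (by ring)
    refine (Metric.closedBall_subset_closedBall ?_).trans hsub
    push_cast
    nlinarith [mul_nonneg (Nat.cast_nonneg (α := ℝ) j) hδ.le]

theorem HasWeightedMean.contDiffOn (hB : IsOpen B) (hg : HasWeightedMean g B)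
    (hc : ContinuousOn g B) (N : ℕ) : ContDiffOn ℝ N g B := by
  have h : ∀ m : ℕ, ∀ x ∈ B, iteratedFDerivWithin ℝ m g B x = iteratedFDeriv ℝ m g x :=
    fun m => iteratedFDerivWithin_of_isOpen m hB
  refine contDiffOn_of_continuousOn_differentiableOn (n := (N : ℕ∞)) (fun m _ => ?_) fun m _ => ?_
  · exact (hg.mean_iteratedFDeriv hB hc m).2.congr (h m)
  · obtain ⟨hm, hmc⟩ := hg.mean_iteratedFDeriv hB hc m
    exact (hm.differentiableOn hB hmc).1.congr (h m)

open scoped Nat in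
theorem HasWeightedMean.analyticOnNhd (hB : IsOpen B) (hg : HasWeightedMean g B)
    (hc : ContinuousOn g B) : AnalyticOnNhd ℝ g B := by
  intro x₀ hx₀
  obtain ⟨r, hr, hsub⟩ := Metric.nhds_basis_closedBall.mem_iff.1 (hB.mem_nhds hx₀)
  obtain ⟨M, hM⟩ := (isCompact_closedBall x₀ r).exists_bound_of_continuousOn (hc.mono hsub)
  have hM0 : 0 ≤ M := (norm_nonneg _).trans (hM x₀ (Metric.mem_closedBall_self hr.le))
  have hincl : ∀ x ∈ Metric.ball x₀ (r / 2),
      Metric.closedBall x (r / 2) ⊆ Metric.closedBall x₀ r := by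
    intro x hx
    refine Metric.closedBall_subset_closedBall' ?_
    rw [Metric.mem_ball] at hx
    linarith
  have hC := gradientConst_nonneg (n := n)
  refine analyticAt_of_norm_iteratedFDeriv_le (R := r / 2) (M := M)
    (A := gradientConst n / (r / 2) * Real.exp 1 + 1) (by positivity) (by positivity)
    (fun x hx j => ?_) fun x hx j => ?_
  · exact (hg.contDiffOn hB hc j).contDiffAt
      (hB.mem_nhds (hsub (hincl x hx (Metric.mem_closedBall_self (by positivity)))))
  · have hjM : ‖iteratedFDeriv ℝ j g x‖ ≤
        (gradientConst n / (r / 2)) ^ j * (j : ℝ) ^ j * M := by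
      rcases Nat.eq_zero_or_pos j with rfl | hj
      · simpa using hM x (hincl x hx (Metric.mem_closedBall_self (by positivity)))
      · have hj' : (0 : ℝ) < j := by exact_mod_cast hj
        have h1 : (j : ℝ) * (r / 2 / j) = r / 2 := by field_simp
        have := hg.norm_iteratedFDeriv_le hB hc (δ := r / 2 / j) (M := M) (by positivity) j x
          (by rw [h1]; exact (hincl x hx).trans hsub)
          (by rw [h1]; exact fun z hz => hM z (hincl x hx hz))
        refine this.trans_eq ?_
        rw [← mul_pow]
        congr 2
        field_simp
    have h2 : (0 : ℝ) < j ! := by exact_mod_cast j.factorial_pos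
    have h3 : (j : ℝ) ^ j ≤ Real.exp 1 ^ j * j ! := by
      have := Real.pow_div_factorial_le_exp (j : ℝ) (Nat.cast_nonneg j) j
      rw [div_le_iff₀ h2] at this
      rwa [← Real.exp_nat_mul, mul_one]
    calc _ ≤ (gradientConst n / (r / 2)) ^ j * (j : ℝ) ^ j * M := hjM
      _ ≤ (gradientConst n / (r / 2)) ^ j * (Real.exp 1 ^ j * j !) * M := by gcongr
      _ = M * (gradientConst n / (r / 2) * Real.exp 1) ^ j * j ! := by rw [mul_pow]; ring
      _ ≤ _ := by gcongr; linarith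

end

namespace MvPolynomial

theorem pderiv_pderiv_comm {σ R : Type*} [CommSemiring R] (i j : σ) (p : MvPolynomial σ R) :
    pderiv i (pderiv j p) = pderiv j (pderiv i p) := by
  classical
  rcases eq_or_ne i j with rfl | hij
  · rfl
  ext m
  simp only [coeff_pderiv, Finsupp.add_apply, Finsupp.single_apply, hij, hij.symm, if_false,
    add_zero]
  rw [add_right_comm, mul_right_comm]

variable {n : ℕ}

theorem contDiff_eval (p : MvPolynomial (Fin n) ℝ) (N : ℕ) :
    ContDiff ℝ N fun x : Fin n → ℝ => eval x p :=
  contDiffOn_univ.1 ((AnalyticOnNhd.eval_mvPolynomial (𝕜 := ℝ) p).contDiffOn uniqueDiffOn_univ)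

theorem hasFDerivAt_eval (p : MvPolynomial (Fin n) ℝ) (x : Fin n → ℝ) :
    HasFDerivAt (fun x : Fin n → ℝ => eval x p)
      (∑ i, eval x (pderiv i p) • ContinuousLinearMap.proj (R := ℝ) (φ := fun _ : Fin n => ℝ) i)
      x := by
  induction p using MvPolynomial.induction_on with
  | C a => simpa using hasFDerivAt_const a x
  | add p q hp hq => simpa [add_smul, Finset.sum_add_distrib] using hp.fun_add hq
  | mul_X p j hp =>
    have h := hp.mul (hasFDerivAt_apply (𝕜 := ℝ) (F' := fun _ : Fin n => ℝ) j x)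
    simp only [map_mul, eval_X]
    refine h.congr_fderiv ?_
    ext e
    simp only [pderiv_mul, pderiv_X, map_add, map_mul, eval_X]
    have h1 : ∀ i, eval x (Pi.single (M := fun _ => MvPolynomial (Fin n) ℝ) i 1 j) =
        if j = i then 1 else 0 := fun i => by
      rw [Pi.single_apply]
      split_ifs <;> simp
    simp only [h1, add_smul, Finset.sum_add_distrib]
    simp [Finset.mul_sum, mul_comm, mul_left_comm]
    ring

theorem fderiv_eval_single (p : MvPolynomial (Fin n) ℝ) (x : Fin n → ℝ) (i : Fin n) :
    fderiv ℝ (fun x : Fin n → ℝ => eval x p) x (Pi.single i 1) = eval x (pderiv i p) := by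
  rw [(hasFDerivAt_eval p x).fderiv]
  simp [Pi.single_apply]

/-- The formal Laplacian. -/
noncomputable def laplacian (p : MvPolynomial (Fin n) ℝ) : MvPolynomial (Fin n) ℝ :=
  ∑ i, pderiv i (pderiv i p)

theorem coordLaplacian_eval (p : MvPolynomial (Fin n) ℝ) (x : Fin n → ℝ) :
    coordLaplacian (fun x : Fin n → ℝ => eval x p) x = eval x p.laplacian := by
  rw [laplacian, map_sum, coordLaplacian]
  refine Finset.sum_congr rfl fun i _ => ?_
  rw [iteratedFDeriv_two_apply, ← fderiv_eval_single]
  simp_rw [← fderiv_eval_single]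
  have h := ((contDiff_eval p 2).fderiv_right (m := 1) (by norm_num)).differentiable
    one_ne_zero x
  rw [fderiv_clm_apply h (differentiableAt_const _)]
  simp

theorem laplacian_pderiv (p : MvPolynomial (Fin n) ℝ) (i : Fin n) :
    (pderiv i p).laplacian = pderiv i p.laplacian := by
  simp only [laplacian, map_sum]
  refine Finset.sum_congr rfl fun j _ => ?_
  rw [pderiv_pderiv_comm j i p, pderiv_pderiv_comm j i]

/-- Integration of a polynomial against `ballWeight k`. -/
noncomputable def ballIntegral (k : ℕ) (p : MvPolynomial (Fin n) ℝ) : ℝ :=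
  ∫ y, ballWeight k y • eval y p

theorem integrable_ballWeight_eval (k : ℕ) (p : MvPolynomial (Fin n) ℝ) :
    Integrable fun y => ballWeight k y • eval y p :=
  integrable_ballWeight_smul k (contDiff_eval p 0).continuous

theorem ballIntegral_add (k : ℕ) (p q : MvPolynomial (Fin n) ℝ) :
    ballIntegral k (p + q) = ballIntegral k p + ballIntegral k q := by
  simp only [ballIntegral, map_add, smul_add]
  exact integral_add (integrable_ballWeight_eval k p) (integrable_ballWeight_eval k q)

theorem ballIntegral_sum (k : ℕ) {ι : Type*} (s : Finset ι) (p : ι → MvPolynomial (Fin n) ℝ) :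
    ballIntegral k (∑ i ∈ s, p i) = ∑ i ∈ s, ballIntegral k (p i) := by
  simp only [ballIntegral, map_sum, Finset.smul_sum]
  exact integral_finsetSum s fun i _ => integrable_ballWeight_eval k (p i)

theorem ballIntegral_pderiv (k : ℕ) (p : MvPolynomial (Fin n) ℝ) (i : Fin n) :
    ballIntegral (k + 1) (pderiv i p) = 2 * (k + 2) * ballIntegral k (X i * p) := by
  have := integral_ballWeight_smul_fderiv k (contDiff_eval p 1) i
  simp_rw [fderiv_eval_single] at this
  simpa [ballIntegral] using this

theorem ballIntegral_mul_eq_zero {d : ℕ} {H Q : MvPolynomial (Fin n) ℝ} (hH : H.IsHomogeneous d)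
    (hlap : H.laplacian = 0) (hQ : ∀ m ∈ Q.support, m.degree < d) (k : ℕ) :
    ballIntegral k (H * Q) = 0 := by
  induction d generalizing H Q k with
  | zero =>
    have : Q = 0 := by
      rw [← support_eq_empty]
      exact Finset.eq_empty_of_forall_notMem fun m hm => by simpa using hQ m hm
    simp [this, ballIntegral]
  | succ d ih =>
    have hpQ : ∀ i, ∀ m ∈ (pderiv i Q).support, m.degree < d := by
      intro i m hm
      rw [mem_support_iff, coeff_pderiv] at hm
      have := hQ _ (mem_support_iff.2 (left_ne_zero_of_mul hm))
      simpa using this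
    have h1 : ∀ i, ballIntegral k (X i * (pderiv i H * Q)) =
        (2 * (k + 2) : ℝ)⁻¹ * ballIntegral (k + 1) (pderiv i (pderiv i H) * Q) := by
      intro i
      have h2 := ballIntegral_pderiv k (pderiv i H * Q) i
      rw [pderiv_mul, ballIntegral_add, ih (by simpa using hH.pderiv)
        (by rw [laplacian_pderiv, hlap, map_zero]) (hpQ i), add_zero] at h2
      rw [h2, inv_mul_cancel_left₀ (by positivity)]
    have h3 : ∑ i, ballIntegral k (X i * (pderiv i H * Q)) = (d + 1) * ballIntegral k (H * Q) := by
      rw [← ballIntegral_sum]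
      simp_rw [← mul_assoc]
      rw [← Finset.sum_mul, hH.sum_X_mul_pderiv]
      simp only [ballIntegral, map_mul, nsmul_eq_mul, smul_eq_mul, map_natCast]
      rw [← integral_const_mul]
      congr 1
      funext y
      push_cast
      ring
    simp_rw [h1] at h3
    rw [← Finset.mul_sum, ← ballIntegral_sum, ← Finset.sum_mul] at h3
    change _ * ballIntegral (k + 1) (H.laplacian * Q) = _ at h3
    have h4 : ballIntegral (k + 1) (H.laplacian * Q) = 0 := by simp [hlap, ballIntegral]
    rw [h4, mul_zero] at h3
    exact (mul_eq_zero.1 h3.symm).resolve_left (by positivity)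

theorem isUnit_of_mul_harmonic_of_nonneg {d : ℕ} {P Q : MvPolynomial (Fin n) ℝ}
    (hH : (P * Q).IsHomogeneous d) (hlap : (P * Q).laplacian = 0) (hne : P * Q ≠ 0)
    (hP : ∀ x, 0 ≤ eval x P) : IsUnit P := by
  have hP0 := left_ne_zero_of_mul hne
  have hQ0 := right_ne_zero_of_mul hne
  rw [isUnit_iff_totalDegree_of_isReduced]
  have hdeg := totalDegree_mul_of_isDomain hP0 hQ0
  rw [hH.totalDegree hne] at hdeg
  have htd : P.totalDegree = 0 := by
    by_contra hpos
    have h0 := ballIntegral_mul_eq_zero hH hlap (Q := Q) (fun m hm => by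
      have : m.degree ≤ Q.totalDegree := by
        simpa only [Finsupp.degree_apply, Finsupp.sum] using le_totalDegree hm
      omega) 0
    obtain ⟨x, hx, hxne⟩ := exists_eval_ne_zero_of_isOpen (mul_ne_zero hne hQ0)
      (isOpen_lt continuous_const (continuous_ballWeight (n := n) 0)) ⟨0, ballWeight_zero_pos 0⟩
    refine (Continuous.integral_pos_of_hasCompactSupport_nonneg_nonzero
      (f := fun y => ballWeight 0 y • eval y (P * Q * Q)) ?_ ?_ ?_ (x := x) ?_).ne' h0
    · exact (continuous_ballWeight 0).smul (contDiff_eval _ 0).continuous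
    · exact (hasCompactSupport_ballWeight 0).smul_right
    · intro y
      simp only [map_mul, smul_eq_mul, Pi.zero_apply]
      have := mul_nonneg (mul_nonneg (ballWeight_nonneg 0 y) (hP y)) (mul_self_nonneg (eval y Q))
      linarith
    · exact smul_ne_zero (ne_of_gt hx) hxne
  refine ⟨?_, htd⟩
  rw [totalDegree_eq_zero_iff_eq_C] at htd
  rw [isUnit_iff_ne_zero]
  intro h
  rw [h, C_0] at htd
  exact hP0 htd

theorem harmonic_dvd_of_eval_eq_zero_on_signChangeSet {m d : ℕ}
    {H p : MvPolynomial (Fin (m + 1)) ℝ} (hH : H.IsHomogeneous d) (hlap : H.laplacian = 0)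
    (hne : H ≠ 0) (hp : ∀ z ∈ signChangeSet (fun z => eval z H), eval z p = 0) : H ∣ p := by
  refine squarefree_dvd_of_eval_eq_zero_on_signChangeSet ?_ ?_ hp
  · rintro a ⟨c, rfl⟩
    exact isUnit_of_mul_isUnit_left (isUnit_of_mul_harmonic_of_nonneg hH hlap hne fun x => by
      rw [map_mul]; exact mul_self_nonneg _)
  · rintro a ha ⟨c, rfl⟩
    constructor
    · by_contra! h
      rw [← neg_mul_neg] at hH hlap hne
      refine ha.not_isUnit (IsUnit.neg_iff a |>.1
        (isUnit_of_mul_harmonic_of_nonneg hH hlap hne fun x => ?_))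
      simpa using h x
    · by_contra! h
      exact ha.not_isUnit (isUnit_of_mul_harmonic_of_nonneg hH hlap hne h)

end MvPolynomial

namespace MvPolynomial

variable {n : ℕ}

/-- The `ℓ¹` norm of the coefficients with weights `wᵅ`. -/
noncomputable def weightedNorm (w : Fin n → ℝ) (p : MvPolynomial (Fin n) ℝ) : ℝ :=
  ∑ α ∈ p.support, |coeff α p| * ∏ i, w i ^ α i

variable {w : Fin n → ℝ}

theorem weightedNorm_eq_sum {p : MvPolynomial (Fin n) ℝ} {s : Finset (Fin n →₀ ℕ)}
    (hs : p.support ⊆ s) : weightedNorm w p = ∑ α ∈ s, |coeff α p| * ∏ i, w i ^ α i := by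
  refine Finset.sum_subset hs fun _ _ hα => ?_
  rw [notMem_support_iff.1 hα, abs_zero, zero_mul]

theorem weightedNorm_nonneg (hw : ∀ i, 0 ≤ w i) (p : MvPolynomial (Fin n) ℝ) :
    0 ≤ weightedNorm w p :=
  Finset.sum_nonneg fun _ _ =>
    mul_nonneg (abs_nonneg _) (Finset.prod_nonneg fun i _ => pow_nonneg (hw i) _)

@[simp] theorem weightedNorm_zero : weightedNorm w (0 : MvPolynomial (Fin n) ℝ) = 0 := by
  simp [weightedNorm]

theorem weightedNorm_neg (p : MvPolynomial (Fin n) ℝ) : weightedNorm w (-p) = weightedNorm w p := by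
  simp [weightedNorm]

theorem weightedNorm_add_le (hw : ∀ i, 0 ≤ w i) (p q : MvPolynomial (Fin n) ℝ) :
    weightedNorm w (p + q) ≤ weightedNorm w p + weightedNorm w q := by
  classical
  rw [weightedNorm_eq_sum (support_add (p := p) (q := q)),
    weightedNorm_eq_sum (p := p) (Finset.subset_union_left (s₂ := q.support)),
    weightedNorm_eq_sum (p := q) (Finset.subset_union_right (s₁ := p.support)),
    ← Finset.sum_add_distrib]
  refine Finset.sum_le_sum fun α _ => ?_
  rw [← add_mul, coeff_add]
  have := Finset.prod_nonneg fun i (_ : i ∈ Finset.univ) => pow_nonneg (hw i) (α i)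
  gcongr
  exact abs_add_le _ _

theorem weightedNorm_sub_le (hw : ∀ i, 0 ≤ w i) (p q : MvPolynomial (Fin n) ℝ) :
    weightedNorm w (p - q) ≤ weightedNorm w p + weightedNorm w q := by
  rw [sub_eq_add_neg, ← weightedNorm_neg q]
  exact weightedNorm_add_le hw _ _

theorem weightedNorm_sum_le (hw : ∀ i, 0 ≤ w i) {ι : Type*} (s : Finset ι)
    (p : ι → MvPolynomial (Fin n) ℝ) :
    weightedNorm w (∑ i ∈ s, p i) ≤ ∑ i ∈ s, weightedNorm w (p i) :=
  Finset.le_sum_of_subadditive _ weightedNorm_zero.le (weightedNorm_add_le hw) s p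

theorem weightedNorm_monomial (α : Fin n →₀ ℕ) (c : ℝ) :
    weightedNorm w (monomial α c) = |c| * ∏ i, w i ^ α i := by
  classical
  rw [weightedNorm_eq_sum support_monomial_subset]
  simp

theorem weightedNorm_mul_le (hw : ∀ i, 0 ≤ w i) (p q : MvPolynomial (Fin n) ℝ) :
    weightedNorm w (p * q) ≤ weightedNorm w p * weightedNorm w q := by
  conv_lhs => rw [p.as_sum, q.as_sum, Finset.sum_mul_sum]
  refine (weightedNorm_sum_le hw _ _).trans ?_
  rw [weightedNorm, weightedNorm, Finset.sum_mul_sum]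
  refine Finset.sum_le_sum fun α _ => (weightedNorm_sum_le hw _ _).trans ?_
  refine Finset.sum_le_sum fun β _ => ?_
  rw [monomial_mul, weightedNorm_monomial, abs_mul]
  simp only [Finsupp.add_apply, pow_add, Finset.prod_mul_distrib]
  exact le_of_eq (by ring)

theorem weightedNorm_monomial_mul (β : Fin n →₀ ℕ) (c : ℝ) (q : MvPolynomial (Fin n) ℝ) :
    weightedNorm w (monomial β c * q) = (|c| * ∏ i, w i ^ β i) * weightedNorm w q := by
  classical
  have hs : (monomial β c * q).support ⊆ q.support.map (addLeftEmbedding β) := by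
    intro γ hγ
    have h := support_mul _ _ hγ
    obtain ⟨a, ha, b, hb, rfl⟩ := Finset.mem_add.1 h
    rw [Finset.mem_map]
    refine ⟨b, hb, ?_⟩
    rw [Finset.mem_singleton.1 (support_monomial_subset ha)]
    rfl
  rw [weightedNorm_eq_sum hs, Finset.sum_map, weightedNorm, Finset.mul_sum]
  refine Finset.sum_congr rfl fun α _ => ?_
  simp only [addLeftEmbedding_apply, coeff_monomial_mul, abs_mul, Finsupp.add_apply, pow_add,
    Finset.prod_mul_distrib]
  ring

theorem abs_eval_le_weightedNorm {y : Fin n → ℝ} (hy : ∀ i, |y i| ≤ w i)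
    (p : MvPolynomial (Fin n) ℝ) : |eval y p| ≤ weightedNorm w p := by
  rw [eval_eq']
  refine (Finset.abs_sum_le_sum_abs _ _).trans (Finset.sum_le_sum fun α _ => ?_)
  rw [abs_mul, Finset.abs_prod]
  gcongr with i
  rw [abs_pow]
  gcongr
  exact hy i

theorem weightedNorm_mono {w' : Fin n → ℝ} (hw : ∀ i, 0 ≤ w i) (hww : ∀ i, w i ≤ w' i)
    (p : MvPolynomial (Fin n) ℝ) : weightedNorm w p ≤ weightedNorm w' p := by
  refine Finset.sum_le_sum fun α _ => ?_
  gcongr with i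
  · exact fun i _ => pow_nonneg (hw i) _
  · exact hw i
  · exact hww i

theorem IsHomogeneous.weightedNorm_smul {p : MvPolynomial (Fin n) ℝ} {d : ℕ}
    (hp : p.IsHomogeneous d) (s : ℝ) : weightedNorm (s • w) p = s ^ d * weightedNorm w p := by
  rw [weightedNorm, weightedNorm, Finset.mul_sum]
  refine Finset.sum_congr rfl fun α hα => ?_
  simp only [Pi.smul_apply, smul_eq_mul, mul_pow, Finset.prod_mul_distrib]
  rw [Finset.prod_pow_eq_pow_sum, ← hp (mem_support_iff.1 hα)]
  have : Finsupp.weight 1 α = ∑ i, α i := by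
    simp [Finsupp.weight_apply, Finsupp.sum_fintype]
  rw [this]
  ring

theorem exists_mul_weightedNorm_le_weightedNorm_mul {H : MvPolynomial (Fin n) ℝ} (hH : H ≠ 0) :
    ∃ w : Fin n → ℝ, (∀ i, 0 < w i) ∧ ∃ κ > 0, ∀ q : MvPolynomial (Fin n) ℝ,
      κ * weightedNorm w q ≤ weightedNorm w (q * H) := by
  classical
  obtain ⟨β, hβ, hmax⟩ := H.support.exists_max_image (fun α => ∑ i, α i ^ 2)
    (Finset.nonempty_iff_ne_empty.2 (mt support_eq_empty.1 hH))
  have hc : 0 < |coeff β H| := abs_pos.2 (mem_support_iff.1 hβ)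
  set S := ∑ α ∈ H.support.erase β, |coeff α H| with hS
  have hS0 : 0 ≤ S := Finset.sum_nonneg fun _ _ => abs_nonneg _
  set T := 1 + 2 * S / |coeff β H| with hT
  have hT1 : 1 ≤ T := by rw [hT]; linarith [show 0 ≤ 2 * S / |coeff β H| by positivity]
  let w : Fin n → ℝ := fun i => T ^ β i
  have hw : ∀ i, 0 < w i := fun i => by positivity
  have hwα : ∀ α : Fin n →₀ ℕ, ∏ i, w i ^ α i = T ^ ∑ i, β i * α i := fun α => by
    simp only [w, ← pow_mul]
    rw [Finset.prod_pow_eq_pow_sum]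
  have hdot : ∀ α ∈ H.support.erase β, ∑ i, β i * α i + 1 ≤ ∑ i, β i * β i := by
    intro α hα
    rw [Finset.mem_erase] at hα
    have h1 := hmax α hα.2
    obtain ⟨i, hi⟩ : ∃ i, α i ≠ β i := by
      by_contra! h
      exact hα.1 (Finsupp.ext h)
    have h2 : (0 : ℤ) < ∑ i, ((α i : ℤ) - β i) ^ 2 :=
      Finset.sum_pos' (fun _ _ => sq_nonneg _) ⟨i, Finset.mem_univ i, by
        have : (α i : ℤ) - β i ≠ 0 := sub_ne_zero.2 (by exact_mod_cast hi)
        positivity⟩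
    have h3 : ∑ i, ((α i : ℤ) - β i) ^ 2 =
        (∑ i, (α i : ℤ) ^ 2) - 2 * (∑ i, (β i : ℤ) * α i) + ∑ i, (β i : ℤ) * β i := by
      rw [Finset.mul_sum, ← Finset.sum_sub_distrib, ← Finset.sum_add_distrib]
      exact Finset.sum_congr rfl fun i _ => by ring
    have h4 : (∑ i, (α i : ℤ) ^ 2) ≤ ∑ i, (β i : ℤ) * β i := by
      simp_rw [← sq]
      exact_mod_cast h1
    zify
    linarith
  have hrest : weightedNorm w (H - monomial β (coeff β H)) ≤
      1 / 2 * (|coeff β H| * ∏ i, w i ^ β i) := by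
    have hsplit : H - monomial β (coeff β H) =
        ∑ α ∈ H.support.erase β, monomial α (coeff α H) := by
      rw [sub_eq_iff_eq_add', Finset.add_sum_erase _ (fun α => monomial α (coeff α H)) hβ,
        ← H.as_sum]
    rw [hsplit]
    refine (weightedNorm_sum_le (fun i => (hw i).le) _ _).trans ?_
    have hT0 : 0 < T := by linarith
    have h5 : ∀ α ∈ H.support.erase β, weightedNorm w (monomial α (coeff α H)) ≤
        |coeff α H| * ((∏ i, w i ^ β i) / T) := by
      intro α hα
      rw [weightedNorm_monomial, hwα, hwα]
      gcongr
      rw [le_div_iff₀ hT0, ← pow_succ]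
      exact pow_le_pow_right₀ hT1 (hdot α hα)
    refine (Finset.sum_le_sum h5).trans ?_
    rw [← Finset.sum_mul, ← hS]
    have hP : 0 < ∏ i, w i ^ β i := Finset.prod_pos fun i _ => pow_pos (hw i) _
    have h6 : S / T ≤ 1 / 2 * |coeff β H| := by
      rw [div_le_iff₀ hT0, hT]
      field_simp
      linarith
    calc S * ((∏ i, w i ^ β i) / T) = S / T * ∏ i, w i ^ β i := by ring
      _ ≤ 1 / 2 * |coeff β H| * ∏ i, w i ^ β i := by gcongr
      _ = _ := by ring
  refine ⟨w, hw, 1 / 2 * (|coeff β H| * ∏ i, w i ^ β i), ?_, fun q => ?_⟩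
  · have hP : 0 < ∏ i, w i ^ β i := Finset.prod_pos fun i _ => pow_pos (hw i) _
    positivity
  · have hw' := fun i => (hw i).le
    have h7 : monomial β (coeff β H) * q = q * H - q * (H - monomial β (coeff β H)) := by ring
    have h8 := weightedNorm_sub_le hw' (q * H) (q * (H - monomial β (coeff β H)))
    rw [← h7, weightedNorm_monomial_mul] at h8
    have h9 := (weightedNorm_mul_le hw' q (H - monomial β (coeff β H))).trans
      (mul_le_mul_of_nonneg_left hrest (weightedNorm_nonneg hw' q))
    linarith

end MvPolynomial

section

open MvPolynomial

variable {n : ℕ}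

theorem MvPolynomial.weightedNorm_C {w : Fin n → ℝ} (c : ℝ) :
    weightedNorm w (C c : MvPolynomial (Fin n) ℝ) = |c| := by
  rw [← monomial_zero', weightedNorm_monomial]
  simp

theorem MvPolynomial.weightedNorm_X {w : Fin n → ℝ} (i : Fin n) :
    weightedNorm w (X i : MvPolynomial (Fin n) ℝ) = w i := by
  rw [X, weightedNorm_monomial, Finset.prod_eq_single i]
  · simp
  · intro j _ hj
    simp [hj.symm]
  · simp

theorem MvPolynomial.weightedNorm_prod_le {w : Fin n → ℝ} (hw : ∀ i, 0 ≤ w i) {ι : Type*}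
    (s : Finset ι) (p : ι → MvPolynomial (Fin n) ℝ) :
    weightedNorm w (∏ i ∈ s, p i) ≤ ∏ i ∈ s, weightedNorm w (p i) := by
  classical
  induction s using Finset.induction_on with
  | empty => simpa using (weightedNorm_C (w := w) (1 : ℝ)).le
  | insert a s ha ih =>
    rw [Finset.prod_insert ha, Finset.prod_insert ha]
    exact (weightedNorm_mul_le hw _ _).trans
      (mul_le_mul_of_nonneg_left ih (weightedNorm_nonneg hw _))

theorem exists_pos_forall_le {ι : Type*} [Finite ι] {w : ι → ℝ} (hw : ∀ i, 0 < w i) :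
    ∃ r : ℝ, 0 < r ∧ ∀ i, r ≤ w i := by
  rcases isEmpty_or_nonempty ι with hι | hι
  · exact ⟨1, one_pos, fun i => isEmptyElim i⟩
  · obtain ⟨i, hi⟩ := Finite.exists_min w
    exact ⟨w i, hw i, hi⟩

/-- `f` is the sum of the homogeneous polynomials `φ j` on the polydisc of polyradius `w`, with
absolute convergence of the sum of all monomials. -/
structure HasHomogeneousExpansion (f : (Fin n → ℝ) → ℝ) (φ : ℕ → MvPolynomial (Fin n) ℝ)
    (w : Fin n → ℝ) : Prop where
  isHomogeneous : ∀ j, (φ j).IsHomogeneous j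
  summable : Summable fun j => weightedNorm w (φ j)
  hasSum : ∀ y : Fin n → ℝ, (∀ i, |y i| ≤ w i) → HasSum (fun j => eval y (φ j)) (f y)

theorem ContinuousMultilinearMap.exists_homogeneous_eval {j : ℕ}
    (p : ContinuousMultilinearMap ℝ (fun _ : Fin j => Fin n → ℝ) ℝ) :
    ∃ φ : MvPolynomial (Fin n) ℝ, φ.IsHomogeneous j ∧ (∀ y, eval y φ = p fun _ => y) ∧
      ∀ r : ℝ, 0 ≤ r → weightedNorm (fun _ => r) φ ≤ ‖p‖ * (n * r) ^ j := by
  classical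
  refine ⟨∑ s : Fin j → Fin n, C (p fun k => Pi.single (s k) 1) * ∏ k, X (s k), ?_, ?_, ?_⟩
  · refine IsHomogeneous.sum _ _ _ fun s _ => ?_
    have h := (isHomogeneous_C (Fin n) (p fun k => Pi.single (s k) 1)).mul
      (IsHomogeneous.prod Finset.univ (fun k => (X (s k) : MvPolynomial (Fin n) ℝ)) (fun _ => 1)
        fun k _ => isHomogeneous_X ℝ (s k))
    simpa using h
  · intro y
    have hy : y = ∑ i, y i • (Pi.single i (1 : ℝ) : Fin n → ℝ) := by
      ext k
      simp [Finset.sum_apply, Pi.single_apply]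
    conv_rhs => rw [hy]
    rw [ContinuousMultilinearMap.map_sum, _root_.map_sum (eval y)]
    refine Finset.sum_congr rfl fun s _ => ?_
    rw [ContinuousMultilinearMap.map_smul_univ]
    simp [mul_comm, map_prod]
  · intro r hr
    have hw : ∀ _ : Fin n, 0 ≤ r := fun _ => hr
    refine (weightedNorm_sum_le hw _ _).trans ?_
    have h : ∀ s ∈ (Finset.univ : Finset (Fin j → Fin n)),
        weightedNorm (fun _ => r) (C (p fun k => Pi.single (s k) 1) * ∏ k, X (s k)) ≤
          ‖p‖ * r ^ j := by
      intro s _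
      refine (weightedNorm_mul_le hw _ _).trans ?_
      have h1 := weightedNorm_prod_le hw Finset.univ
        (fun k => (X (s k) : MvPolynomial (Fin n) ℝ))
      simp only [weightedNorm_X, Finset.prod_const, Finset.card_univ, Fintype.card_fin] at h1
      rw [weightedNorm_C]
      have h2 := p.le_opNorm fun k => Pi.single (s k) 1
      have h3 : ∏ k, ‖(Pi.single (s k) 1 : Fin n → ℝ)‖ = 1 :=
        Finset.prod_eq_one fun k _ => by rw [Pi.norm_single]; simp
      rw [h3, mul_one, Real.norm_eq_abs] at h2
      exact mul_le_mul h2 h1 (weightedNorm_nonneg hw _) (norm_nonneg _)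
    refine (Finset.sum_le_sum h).trans (le_of_eq ?_)
    simp [mul_pow]
    ring

theorem AnalyticAt.exists_hasHomogeneousExpansion {u : (Fin n → ℝ) → ℝ} {x₀ : Fin n → ℝ}
    (hu : AnalyticAt ℝ u x₀) : ∃ φ : ℕ → MvPolynomial (Fin n) ℝ, ∃ r > 0,
      HasHomogeneousExpansion (fun y => u (x₀ + y)) φ (fun _ => r) := by
  obtain ⟨p, R, hp⟩ := hu
  obtain ⟨A, B, hA, hB, hAB⟩ :=
    p.le_mul_pow_of_radius_pos (hp.r_pos.trans_le hp.r_le)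
  choose φ hφ hev hnorm using fun j => (p j).exists_homogeneous_eval
  obtain ⟨ε, hε, hεR⟩ : ∃ ε : ℝ, 0 < ε ∧ ENNReal.ofReal ε < R := by
    obtain ⟨q, hq0, hqR⟩ := ENNReal.lt_iff_exists_nnreal_btwn.1 hp.r_pos
    exact ⟨q, by exact_mod_cast hq0, by simpa using hqR⟩
  set r := min ε (1 / (2 * (n + 1) * B)) with hr
  have hr0 : 0 < r := lt_min hε (by positivity)
  refine ⟨φ, r, hr0, hφ, ?_, fun y hy => ?_⟩
  · refine Summable.of_nonneg_of_le (fun j => weightedNorm_nonneg (fun _ => hr0.le) _)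
      (fun j => ?_) ((summable_geometric_of_lt_one (by norm_num) one_half_lt_one).mul_left A)
    refine (hnorm j r hr0.le).trans ?_
    have h1 : B * (n * r) ≤ 1 / 2 := by
      have : r ≤ 1 / (2 * (n + 1) * B) := min_le_right _ _
      rw [le_div_iff₀ (by positivity)] at this
      nlinarith
    calc ‖p j‖ * (n * r) ^ j ≤ A * B ^ j * (n * r) ^ j := by gcongr; exact hAB j
      _ = A * (B * (n * r)) ^ j := by rw [mul_pow B]; ring
      _ ≤ A * (1 / 2) ^ j := by gcongr
  · have hmem : y ∈ Metric.eball (0 : Fin n → ℝ) R := by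
      rw [Metric.mem_eball, edist_zero_right]
      refine lt_of_le_of_lt ?_ hεR
      rw [← ofReal_norm]
      refine ENNReal.ofReal_le_ofReal ((pi_norm_le_iff_of_nonneg hε.le).2 fun i => ?_)
      exact (hy i).trans (min_le_left _ _)
    simpa only [hev] using hp.hasSum hmem

theorem exists_multilinear_apply_diag (α : Fin n →₀ ℕ) {j : ℕ} (hα : ∑ i, α i = j) :
    ∃ M : ContinuousMultilinearMap ℝ (fun _ : Fin j => Fin n → ℝ) ℝ, ‖M‖ ≤ 1 ∧
      ∀ y : Fin n → ℝ, M (fun _ => y) = ∏ i, y i ^ α i := by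
  set l := (Finsupp.toMultiset α).toList with hl
  have hlen : l.length = j := by
    rw [hl, Multiset.length_toList, Finsupp.card_toMultiset, Finsupp.sum_fintype _ _ (by simp)]
    exact hα
  subst hlen
  refine ⟨(ContinuousMultilinearMap.mkPiAlgebra ℝ (Fin l.length) ℝ).compContinuousLinearMap
    fun k => ContinuousLinearMap.proj (l.get k), ?_, fun y => ?_⟩
  · refine ContinuousMultilinearMap.opNorm_le_bound zero_le_one fun m => ?_
    simp only [ContinuousMultilinearMap.compContinuousLinearMap_apply,
      ContinuousMultilinearMap.mkPiAlgebra_apply, ContinuousLinearMap.proj_apply, norm_prod,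
      one_mul]
    exact Finset.prod_le_prod (fun _ _ => norm_nonneg _) fun k _ => norm_le_pi_norm (m k) _
  · simp only [ContinuousMultilinearMap.compContinuousLinearMap_apply,
      ContinuousMultilinearMap.mkPiAlgebra_apply, ContinuousLinearMap.proj_apply]
    have h1 : ∏ k : Fin l.length, y (l.get k) = (l.map y).prod := by
      rw [← List.prod_ofFn, ← Function.comp_def, ← List.map_ofFn, List.ofFn_get]
    have h2 : (l.map y).prod = ((Finsupp.toMultiset α).map y).prod := by
      rw [← Multiset.coe_toList (Finsupp.toMultiset α), ← hl, Multiset.map_coe,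
        Multiset.prod_coe]
    rw [h1, h2, Finsupp.toMultiset_map, Finsupp.prod_toMultiset,
      Finsupp.prod_mapDomain_index (by simp) (by simp [pow_add]), Finsupp.prod_fintype _ _ (by simp)]

namespace HasHomogeneousExpansion

variable {f g : (Fin n → ℝ) → ℝ} {φ ψ : ℕ → MvPolynomial (Fin n) ℝ} {w : Fin n → ℝ}

theorem mono (h : HasHomogeneousExpansion f φ w) {w' : Fin n → ℝ} (hw' : ∀ i, 0 ≤ w' i)
    (hle : ∀ i, w' i ≤ w i) : HasHomogeneousExpansion f φ w' where
  isHomogeneous := h.isHomogeneous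
  summable := Summable.of_nonneg_of_le (fun _ => weightedNorm_nonneg hw' _)
    (fun _ => weightedNorm_mono hw' hle _) h.summable
  hasSum y hy := h.hasSum y fun i => (hy i).trans (hle i)

theorem sub (hf : HasHomogeneousExpansion f φ w) (hg : HasHomogeneousExpansion g ψ w)
    (hw : ∀ i, 0 ≤ w i) :
    HasHomogeneousExpansion (fun y => f y - g y) (fun j => φ j - ψ j) w where
  isHomogeneous j := (hf.isHomogeneous j).sub (hg.isHomogeneous j)
  summable := Summable.of_nonneg_of_le (fun _ => weightedNorm_nonneg hw _)
    (fun _ => weightedNorm_sub_le hw _ _) (hf.summable.add hg.summable)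
  hasSum y hy := by simpa only [map_sub] using (hf.hasSum y hy).sub (hg.hasSum y hy)

theorem mul (hf : HasHomogeneousExpansion f φ w) (hg : HasHomogeneousExpansion g ψ w)
    (hw : ∀ i, 0 ≤ w i) :
    HasHomogeneousExpansion (fun y => f y * g y)
      (fun j => ∑ p ∈ Finset.HasAntidiagonal.antidiagonal j, φ p.1 * ψ p.2) w where
  isHomogeneous j := IsHomogeneous.sum _ _ _ fun p hp => by
    rw [← Finset.HasAntidiagonal.mem_antidiagonal.1 hp]
    exact (hf.isHomogeneous _).mul (hg.isHomogeneous _)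
  summable := by
    have hsum := hf.summable.mul_of_nonneg hg.summable (fun _ => weightedNorm_nonneg hw _)
      (fun _ => weightedNorm_nonneg hw _)
    have hsum' := summable_sum_mul_antidiagonal_of_summable_mul
      (f := fun j => weightedNorm w (φ j)) (g := fun j => weightedNorm w (ψ j)) hsum
    refine Summable.of_nonneg_of_le (fun _ => weightedNorm_nonneg hw _) (fun j => ?_) hsum'
    exact (weightedNorm_sum_le hw _ _).trans
      (Finset.sum_le_sum fun p _ => weightedNorm_mul_le hw _ _)
  hasSum y hy := by
    have h1 : Summable fun j => ‖eval y (φ j)‖ := Summable.of_nonneg_of_le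
      (fun _ => norm_nonneg _) (fun _ => abs_eval_le_weightedNorm hy _) hf.summable
    have h2 : Summable fun j => ‖eval y (ψ j)‖ := Summable.of_nonneg_of_le
      (fun _ => norm_nonneg _) (fun _ => abs_eval_le_weightedNorm hy _) hg.summable
    have h3 := (summable_norm_sum_mul_antidiagonal_of_summable_norm h1 h2).of_norm.hasSum
    rw [← tsum_mul_tsum_eq_tsum_sum_antidiagonal_of_summable_norm h1 h2, (hf.hasSum y hy).tsum_eq,
      (hg.hasSum y hy).tsum_eq] at h3
    simpa only [map_sum, map_mul] using h3

theorem of_finite (hφ : ∀ j, (φ j).IsHomogeneous j) (d : ℕ) :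
    HasHomogeneousExpansion (fun y => ∑ j ∈ Finset.range d, eval y (φ j))
      (fun j => if j < d then φ j else 0) w where
  isHomogeneous j := by
    split_ifs
    exacts [hφ j, isHomogeneous_zero _ _ _]
  summable := summable_of_ne_finset_zero (s := Finset.range d) fun j hj => by
    rw [if_neg (by simpa using hj), weightedNorm_zero]
  hasSum y _ := by
    have h := hasSum_sum_of_ne_finset_zero (L := .unconditional ℕ) (f := fun j => eval y (if j < d then φ j else 0))
      (s := Finset.range d) fun j hj => by rw [if_neg (by simpa using hj), map_zero]
    convert h using 1
    exact Finset.sum_congr rfl fun j hj => by rw [if_pos (by simpa using hj)]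

theorem abs_sub_le (h : HasHomogeneousExpansion f φ w) (hw : ∀ i, 0 ≤ w i) {D : ℕ}
    (hD : ∀ d < D, φ d = 0) {s₀ : ℝ} (hs₀ : 0 < s₀) {z : Fin n → ℝ}
    (hz : ∀ i, s₀ * |z i| ≤ w i) {s : ℝ} (hs : 0 ≤ s) (hss : s ≤ s₀) :
    |f (s • z) - s ^ D * eval z (φ D)| ≤
      (s / s₀) ^ (D + 1) * ∑' j, weightedNorm w (φ j) := by
  have hsz : ∀ i, |(s • z) i| ≤ w i := fun i => by
    rw [Pi.smul_apply, smul_eq_mul, abs_mul, abs_of_nonneg hs]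
    exact (mul_le_mul_of_nonneg_right hss (abs_nonneg _)).trans (hz i)
  have hsz₀ : ∀ i, |(s₀ • z) i| ≤ w i := fun i => by
    rw [Pi.smul_apply, smul_eq_mul, abs_mul, abs_of_pos hs₀]
    exact hz i
  have h1 := h.hasSum _ hsz
  have h2 := h1.sub (hasSum_ite_eq D (eval (s • z) (φ D)))
  rw [(h.isHomogeneous D).eval_smul] at h2
  have hbound : ∀ j, ‖eval (s • z) (φ j) - (if j = D then s ^ D * eval z (φ D) else 0)‖ ≤
      (s / s₀) ^ (D + 1) * weightedNorm w (φ j) := by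
    intro j
    have hN := weightedNorm_nonneg hw (φ j)
    rcases lt_trichotomy j D with hj | rfl | hj
    · simp [hD j hj, hj.ne]
    · rw [if_pos rfl, (h.isHomogeneous j).eval_smul, sub_self, norm_zero]
      positivity
    · rw [if_neg hj.ne', sub_zero, (h.isHomogeneous j).eval_smul, Real.norm_eq_abs, abs_mul,
        abs_of_nonneg (by positivity)]
      have h3 := abs_eval_le_weightedNorm hsz₀ (φ j)
      rw [(h.isHomogeneous j).eval_smul, abs_mul, abs_of_nonneg (by positivity)] at h3
      calc s ^ j * |eval z (φ j)| = (s / s₀) ^ j * (s₀ ^ j * |eval z (φ j)|) := by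
            rw [← mul_assoc, ← mul_pow, div_mul_cancel₀ _ hs₀.ne']
        _ ≤ (s / s₀) ^ (D + 1) * weightedNorm w (φ j) := by
            gcongr ?_ * ?_
            exact pow_le_pow_of_le_one (by positivity) ((div_le_one hs₀).2 hss) hj
  rw [← h2.tsum_eq, ← tsum_mul_left, ← Real.norm_eq_abs]
  exact tsum_of_norm_bounded (h.summable.mul_left _).hasSum hbound

theorem exists_abs_sub_le (h : HasHomogeneousExpansion f φ w) (hw : ∀ i, 0 < w i) {D : ℕ}
    (hD : ∀ d < D, φ d = 0) {R : ℝ} (hR : 0 < R) :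
    ∃ K s₀ : ℝ, 0 ≤ K ∧ 0 < s₀ ∧ ∀ z : Fin n → ℝ, ‖z‖ ≤ R → ∀ s, 0 ≤ s → s ≤ s₀ →
      |f (s • z) - s ^ D * eval z (φ D)| ≤ K * s ^ (D + 1) := by
  have hw' : ∀ i, 0 ≤ w i := fun i => (hw i).le
  obtain ⟨δ, hδ, hδw⟩ := exists_pos_forall_le hw
  have hs₀ : 0 < δ / R := by positivity
  refine ⟨(∑' j, weightedNorm w (φ j)) / (δ / R) ^ (D + 1), δ / R,
    div_nonneg (tsum_nonneg fun j => weightedNorm_nonneg hw' _) (by positivity), hs₀,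
    fun z hz s hs hss => ?_⟩
  refine (h.abs_sub_le hw' hD hs₀ (fun i => ?_) hs hss).trans (le_of_eq ?_)
  · calc δ / R * |z i| ≤ δ / R * R := by
          gcongr
          exact (norm_le_pi_norm z i).trans hz
      _ = δ := div_mul_cancel₀ _ hR.ne'
      _ ≤ w i := hδw i
  · rw [div_pow]
    ring

theorem analyticAt (h : HasHomogeneousExpansion f φ w) (hw : ∀ i, 0 < w i) :
    AnalyticAt ℝ f 0 := by
  classical
  have hdeg : ∀ j, ∀ α ∈ (φ j).support, ∑ i, α i = j := fun j α hα => by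
    rw [← h.isHomogeneous j (mem_support_iff.1 hα)]
    simp [Finsupp.weight_apply, Finsupp.sum_fintype]
  obtain ⟨r, hr0, hrw⟩ := exists_pos_forall_le hw
  have hex : ∀ j, ∃ M : ContinuousMultilinearMap ℝ (fun _ : Fin j => Fin n → ℝ) ℝ,
      ‖M‖ ≤ weightedNorm (fun _ => 1) (φ j) ∧ ∀ y : Fin n → ℝ, M (fun _ => y) = eval y (φ j) := by
    intro j
    choose M hM hMev using fun α : (φ j).support => exists_multilinear_apply_diag α.1 (hdeg j α α.2)
    refine ⟨∑ α ∈ (φ j).support.attach, coeff α.1 (φ j) • M α, ?_, fun y => ?_⟩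
    · refine (norm_sum_le _ _).trans ?_
      rw [weightedNorm, ← Finset.sum_attach (φ j).support]
      refine Finset.sum_le_sum fun α _ => ?_
      rw [norm_smul, Real.norm_eq_abs]
      simpa using mul_le_mul_of_nonneg_left (hM α) (abs_nonneg (coeff α.1 (φ j)))
    · rw [sum_apply, eval_eq', ← Finset.sum_attach (φ j).support]
      simp [hMev]
  choose p hpn hpe using hex
  refine ⟨p, ENNReal.ofReal r, ?_, by simpa using hr0, fun {y} hy => ?_⟩
  · have hrad : (r.toNNReal : ENNReal) ≤ FormalMultilinearSeries.radius p := by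
      refine FormalMultilinearSeries.le_radius_of_summable_norm p ?_
      rw [Real.coe_toNNReal r hr0.le]
      refine Summable.of_nonneg_of_le (fun j => by positivity) (fun j => ?_) h.summable
      have h1 := (h.isHomogeneous j).weightedNorm_smul (w := fun _ => 1) r
      have h2 := weightedNorm_mono (w := fun _ => r) (fun _ => hr0.le) hrw (φ j)
      have h3 : (r • fun _ : Fin n => (1 : ℝ)) = fun _ => r := by
        ext
        simp
      rw [h3] at h1
      refine le_trans ?_ h2
      rw [h1, mul_comm]
      exact mul_le_mul_of_nonneg_left (hpn j) (by positivity)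
    exact hrad
  · rw [zero_add]
    simp only [hpe]
    refine h.hasSum y fun i => le_trans ?_ (hrw i)
    rw [Metric.mem_eball, edist_zero_right, ← ofReal_norm,
      ENNReal.ofReal_lt_ofReal_iff hr0] at hy
    exact (norm_le_pi_norm y i).trans hy.le

end HasHomogeneousExpansion

end

section

open MvPolynomial

variable {n : ℕ}

theorem HasWeightedMean.comp_const_add {g : (Fin n → ℝ) → ℝ} {B : Set (Fin n → ℝ)}
    (hg : HasWeightedMean g B) (a : Fin n → ℝ) :
    HasWeightedMean (fun y => g (a + y)) ((fun y => a + y) ⁻¹' B) := by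
  intro x r hr hx
  have h := hg (a + x) r hr fun z hz => by
    have h1 : z - a ∈ Metric.closedBall x r := by
      rw [mem_closedBall_iff_norm] at hz ⊢
      rwa [sub_sub]
    simpa using hx h1
  simpa only [add_assoc] using h

theorem integrableOn_ballWeight_smul_comp {g : (Fin n → ℝ) → ℝ} {B : Set (Fin n → ℝ)}
    (hc : ContinuousOn g B) {x : Fin n → ℝ} {r : ℝ} (hr : 0 ≤ r)
    (hx : Metric.closedBall x r ⊆ B) (k : ℕ) :
    IntegrableOn (fun y => ballWeight k y • g (x + r • y)) (Metric.closedBall 0 1) := by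
  refine ContinuousOn.integrableOn_compact (isCompact_closedBall _ _) ?_
  have hmap : ContinuousOn (fun y => x + r • y) (Metric.closedBall (0 : Fin n → ℝ) 1) := by
    fun_prop
  refine (continuous_ballWeight k).continuousOn.smul (hc.comp hmap fun y hy => ?_)
  exact hx (add_smul_mem_closedBall hr hy)

theorem HasHomogeneousExpansion.hasWeightedMean_leading {v : (Fin n → ℝ) → ℝ}
    {V : ℕ → MvPolynomial (Fin n) ℝ} {w : Fin n → ℝ} (hV : HasHomogeneousExpansion v V w)
    (hw : ∀ i, 0 < w i) {m : ℕ} (hm : ∀ d < m, V d = 0) {B : Set (Fin n → ℝ)}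
    (hB : B ∈ nhds 0) (hc : ContinuousOn v B) (hv : HasWeightedMean v B) :
    HasWeightedMean (fun y => eval y (V m)) Set.univ := by
  intro x r hr _
  set W := ∫ y : Fin n → ℝ, ballWeight 1 y with hW
  have hW0 : 0 < W := integral_ballWeight_pos 1
  obtain ⟨ε, hε, hεB⟩ := Metric.nhds_basis_closedBall.mem_iff.1 hB
  set R := ‖x‖ + r with hR
  have hR0 : 0 < R := by positivity
  obtain ⟨K, s₁, hK, hs₁, happrox₁⟩ := hV.exists_abs_sub_le hw hm hR0
  set s₀ := min (ε / R) s₁ with hs₀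
  have hs₀0 : 0 < s₀ := by positivity
  have hsR : s₀ * R ≤ ε :=
    (mul_le_mul_of_nonneg_right (min_le_left _ _) hR0.le).trans (div_mul_cancel₀ _ hR0.ne').le
  have happrox : ∀ z : Fin n → ℝ, ‖z‖ ≤ R → ∀ s, 0 ≤ s → s ≤ s₀ →
      |v (s • z) - s ^ m * eval z (V m)| ≤ K * s ^ (m + 1) := fun z hz s hs hss =>
    happrox₁ z hz s hs (hss.trans (min_le_right _ _))
  have hnorm : ∀ y ∈ Metric.closedBall (0 : Fin n → ℝ) 1, ‖x + r • y‖ ≤ R := by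
    intro y hy
    have h1 := add_smul_mem_closedBall (x := x) hr.le hy
    rw [mem_closedBall_iff_norm] at h1
    have h2 := norm_add_le x (x + r • y - x)
    rw [add_sub_cancel] at h2
    linarith
  set Q := ∫ y, ballWeight 1 y • eval (x + r • y) (V m) with hQ
  have hcont : Continuous fun y : Fin n → ℝ => eval (x + r • y) (V m) :=
    (contDiff_eval (V m) 0).continuous.comp (by fun_prop)
  have hkey : ∀ s, 0 < s → s ≤ s₀ →
      |s ^ m * (Q - W * eval x (V m))| ≤ 2 * W * (K * s ^ (m + 1)) := by
    intro s hs hss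
    have hsub : Metric.closedBall (s • x) (s * r) ⊆ B := by
      intro z hz
      refine hεB ?_
      rw [mem_closedBall_iff_norm] at hz
      rw [mem_closedBall_zero_iff]
      have h2 := norm_add_le (s • x) (z - s • x)
      rw [add_sub_cancel, norm_smul, Real.norm_of_nonneg hs.le] at h2
      have h3 : s * R ≤ ε :=
        (mul_le_mul_of_nonneg_right hss hR0.le).trans hsR
      rw [hR] at h3
      linarith
    have hmean := hv (s • x) (s * r) (by positivity) hsub
    rw [integral_ballWeight_eq_setIntegral, smul_eq_mul, ← hW] at hmean
    have hintg := integrableOn_ballWeight_smul_comp hc (by positivity : 0 ≤ s * r) hsub 1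
    have hint2 : IntegrableOn (fun y => ballWeight 1 y • eval (x + r • y) (V m))
        (Metric.closedBall 0 1) := (integrable_ballWeight_smul 1 hcont).integrableOn
    have hdiff : |∫ y in Metric.closedBall (0 : Fin n → ℝ) 1,
        (ballWeight 1 y • v (s • x + (s * r) • y) -
          s ^ m * (ballWeight 1 y • eval (x + r • y) (V m)))| ≤
        W * (K * s ^ (m + 1)) := by
      have hWset : W = ∫ y in Metric.closedBall (0 : Fin n → ℝ) 1, ballWeight 1 y := by
        have := integral_ballWeight_eq_setIntegral 1 (fun _ : Fin n → ℝ => (1 : ℝ))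
        simpa using this
      rw [hWset, ← integral_mul_const, ← Real.norm_eq_abs]
      refine norm_integral_le_of_norm_le ?_ ?_
      · exact (((continuous_ballWeight 1).integrable_of_hasCompactSupport
          (hasCompactSupport_ballWeight 1)).mul_const _).integrableOn
      · refine (ae_restrict_mem measurableSet_closedBall).mono fun y hy => ?_
        have h4 := happrox _ (hnorm y hy) s hs.le hss
        rw [smul_add, smul_smul] at h4
        rw [smul_eq_mul, smul_eq_mul, mul_left_comm, ← mul_sub, norm_mul, Real.norm_eq_abs,
          Real.norm_eq_abs, abs_of_nonneg (ballWeight_nonneg 1 y)]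
        exact mul_le_mul_of_nonneg_left h4 (ballWeight_nonneg 1 y)
    rw [integral_sub hintg (hint2.const_mul _), integral_const_mul, hmean,
      ← integral_ballWeight_eq_setIntegral, ← hQ] at hdiff
    have h5 := happrox x (by rw [hR]; linarith) s hs.le hss
    have h6 : s ^ m * (Q - W * eval x (V m)) =
        W * (v (s • x) - s ^ m * eval x (V m)) - (W * v (s • x) - s ^ m * Q) := by ring
    rw [h6]
    refine (abs_sub _ _).trans ?_
    rw [abs_mul, abs_of_pos hW0]
    have h7 := mul_le_mul_of_nonneg_left h5 hW0.le
    linarith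
  have hle : ∀ s, 0 < s → s ≤ s₀ →
      |Q - W * eval x (V m)| ≤ s * (2 * W * K) := by
    intro s hs hss
    have h8 := hkey s hs hss
    rw [abs_mul, abs_of_pos (pow_pos hs m)] at h8
    refine le_of_mul_le_mul_left (h8.trans (le_of_eq ?_)) (pow_pos hs m)
    ring
  have hlim : Filter.Tendsto (fun s : ℝ => s * (2 * W * K))
      (nhdsWithin 0 (Set.Ioi 0)) (nhds 0) := by
    have : Continuous fun s : ℝ => s * (2 * W * K) := by fun_prop
    simpa using (this.tendsto 0).mono_left nhdsWithin_le_nhds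
  have hzero : |Q - W * eval x (V m)| ≤ 0 := by
    refine ge_of_tendsto hlim ?_
    filter_upwards [Ioc_mem_nhdsGT hs₀0] with s hs using hle s hs.1 hs.2
  have := abs_nonpos_iff.1 hzero
  rw [smul_eq_mul]
  linarith

theorem MvPolynomial.laplacian_eq_zero_of_hasWeightedMean {H : MvPolynomial (Fin n) ℝ}
    (h : HasWeightedMean (fun y => eval y H) Set.univ) : H.laplacian = 0 := by
  refine MvPolynomial.funext fun x => ?_
  rw [map_zero]
  set G : ℝ → ℝ := fun r => ∫ y, ballWeight 2 y • eval (x + r • y) H.laplacian with hG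
  have hGc : Continuous G := continuous_iff_continuousAt.2 fun r =>
    (hasDerivAt_integral_ballWeight 2 (contDiff_eval H.laplacian 2) x r).continuousAt
  have hG0 : ∀ r > 0, G r = 0 := by
    intro r hr
    have h1 := hasDerivAt_integral_ballWeight 1 (contDiff_eval H 2) x r
    simp only [coordLaplacian_eval] at h1
    have h2 : (fun r : ℝ => ∫ y, ballWeight 1 y • eval (x + r • y) H) =ᶠ[nhds r]
        fun _ => (∫ y : Fin n → ℝ, ballWeight 1 y) • eval x H := by
      filter_upwards [lt_mem_nhds hr] with t ht using h x t ht (Set.subset_univ _)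
    have h3 := h1.unique ((hasDerivAt_const r _).congr_of_eventuallyEq h2)
    rcases mul_eq_zero.1 h3 with h4 | h4
    · have : 0 < r / (2 * (((1 : ℕ) : ℝ) + 2)) := by positivity
      exact absurd h4 this.ne'
    · exact h4
  have h5 : G 0 = 0 := by
    refine tendsto_nhds_unique ((hGc.tendsto 0).mono_left nhdsWithin_le_nhds)
      (Filter.Tendsto.congr' ?_ (tendsto_const_nhds (f := nhdsWithin (0 : ℝ) (Set.Ioi 0))))
    filter_upwards [self_mem_nhdsWithin] with r hr using (hG0 r hr).symm
  simp only [hG, zero_smul, add_zero, smul_eq_mul] at h5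
  rw [integral_mul_const] at h5
  exact (mul_eq_zero.1 h5).resolve_left (integral_ballWeight_pos 2).ne'

end

section

open MvPolynomial

variable {n : ℕ}

theorem MvPolynomial.IsHomogeneous.exists_mul_eq_of_dvd {H p : MvPolynomial (Fin n) ℝ} {m d : ℕ}
    (hH : H.IsHomogeneous m) (hp : p.IsHomogeneous (m + d)) (h : H ∣ p) :
    ∃ c : MvPolynomial (Fin n) ℝ, c.IsHomogeneous d ∧ c * H = p := by
  obtain ⟨c, rfl⟩ := h
  refine ⟨homogeneousComponent d c, homogeneousComponent_isHomogeneous d c, ?_⟩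
  have h1 : homogeneousComponent (m + d) (H * c) = H * c := by
    rw [homogeneousComponent_of_mem hp, if_pos rfl]
  have h2 : H * c = ∑ i ∈ Finset.range (c.totalDegree + 1), H * homogeneousComponent i c := by
    rw [← Finset.mul_sum, sum_homogeneousComponent]
  have h3 : ∀ i ∈ Finset.range (c.totalDegree + 1),
      homogeneousComponent (m + d) (H * homogeneousComponent i c) =
        if d = i then H * homogeneousComponent i c else 0 := fun i _ => by
    rw [homogeneousComponent_of_mem (hH.mul (homogeneousComponent_isHomogeneous i c))]
    simp
  rw [← h1, h2, map_sum, Finset.sum_congr rfl h3, Finset.sum_ite_eq]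
  split_ifs with hd
  · exact mul_comm _ _
  · rw [homogeneousComponent_eq_zero _ _ (by simpa using hd), zero_mul]

theorem MvPolynomial.IsHomogeneous.eq_zero_of_dvd {H p : MvPolynomial (Fin n) ℝ} {m d : ℕ}
    (hH : H.IsHomogeneous m) (hH0 : H ≠ 0) (hp : p.IsHomogeneous d) (h : H ∣ p) (hd : d < m) :
    p = 0 := by
  by_contra hp0
  obtain ⟨c, rfl⟩ := h
  have h1 := hp.totalDegree hp0
  rw [totalDegree_mul_of_isDomain hH0 (right_ne_zero_of_mul hp0), hH.totalDegree hH0] at h1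
  omega

theorem HasHomogeneousExpansion.leading_eq_zero_on_signChangeSet {v g : (Fin n → ℝ) → ℝ}
    {V G : ℕ → MvPolynomial (Fin n) ℝ} {w : Fin n → ℝ} (hV : HasHomogeneousExpansion v V w)
    (hG : HasHomogeneousExpansion g G w) (hw : ∀ i, 0 < w i) {m D : ℕ} (hm : ∀ d < m, V d = 0)
    (hD : ∀ d < D, G d = 0) {ε : ℝ} (hε : 0 < ε)
    (hdense : Metric.ball 0 ε ⊆ closure {y | v y ≠ 0})
    (hg : ∀ y ∈ Metric.ball 0 ε, y ∈ signChangeSet v → g y = 0)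
    {z : Fin n → ℝ} (hz : z ∈ signChangeSet fun y => eval y (V m)) : eval z (G D) = 0 := by
  by_contra hne
  have hcG : Continuous fun y => |eval y (G D)| := (contDiff_eval (G D) 0).continuous.abs
  obtain ⟨ρ, hρ, hρG⟩ := Metric.eventually_nhds_iff_ball.1
    (hcG.continuousAt.eventually (lt_mem_nhds (half_lt_self (abs_pos.2 hne))))
  set c := |eval z (G D)| / 2 with hc
  have hc0 : 0 < c := half_pos (abs_pos.2 hne)
  obtain ⟨a, haρ, ha⟩ := mem_closure_iff_nhds.1 hz.1 _ (Metric.ball_mem_nhds z hρ)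
  obtain ⟨b, hbρ, hb⟩ := mem_closure_iff_nhds.1 hz.2 _ (Metric.ball_mem_nhds z hρ)
  rw [Set.mem_ofPred] at ha hb
  set R := ‖z‖ + ρ with hR
  have hR0 : 0 < R := by positivity
  have hball : ∀ y ∈ Metric.ball z ρ, ‖y‖ ≤ R := fun y hy => by
    rw [mem_ball_iff_norm] at hy
    have := norm_add_le z (y - z)
    rw [add_sub_cancel] at this
    linarith
  obtain ⟨K, s₁, hK, hs₁, hv⟩ := hV.exists_abs_sub_le hw hm hR0
  obtain ⟨L, s₂, hL, hs₂, hg'⟩ := hG.exists_abs_sub_le hw hD hR0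
  have hsmall : ∀ᶠ s : ℝ in nhdsWithin 0 (Set.Ioi 0), 0 < s ∧ s ≤ s₁ ∧ s ≤ s₂ ∧ s * R < ε ∧
      K * s < eval a (V m) ∧ K * s < -eval b (V m) ∧ L * s < c := by
    have hlin : ∀ A B : ℝ, 0 < B → ∀ᶠ s : ℝ in nhdsWithin 0 (Set.Ioi 0), A * s < B := by
      intro A B hB
      have hcont : Continuous fun s : ℝ => A * s := by fun_prop
      refine nhdsWithin_le_nhds (hcont.continuousAt.eventually_lt continuousAt_const ?_)
      simpa using hB
    filter_upwards [self_mem_nhdsWithin, Ioc_mem_nhdsGT hs₁, Ioc_mem_nhdsGT hs₂, hlin R ε hε,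
      hlin K _ ha, hlin K _ (neg_pos.2 hb), hlin L c hc0] with s h0 h1 h2 h3 h4 h5 h6
    exact ⟨h0, h1.2, h2.2, by rwa [mul_comm], h4, h5, h6⟩
  obtain ⟨s, hs, hss₁, hss₂, hsR, hsa, hsb, hsc⟩ := hsmall.exists
  have hpow := pow_pos hs m
  have hva : 0 < v (s • a) := by
    have h1 := (abs_le.1 (hv a (hball a haρ) s hs.le hss₁)).1
    have h2 : K * s ^ (m + 1) < s ^ m * eval a (V m) := by
      rw [pow_succ, mul_left_comm]
      exact mul_lt_mul_of_pos_left hsa hpow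
    linarith
  have hvb : v (s • b) < 0 := by
    have h1 := (abs_le.1 (hv b (hball b hbρ) s hs.le hss₁)).2
    have h2 : K * s ^ (m + 1) < s ^ m * -eval b (V m) := by
      rw [pow_succ, mul_left_comm]
      exact mul_lt_mul_of_pos_left hsb hpow
    linarith
  set S := (fun y => s • y) '' Metric.ball z ρ with hS
  have hSconn : IsPreconnected S :=
    (convex_ball z ρ).isPreconnected.image _ (by fun_prop)
  have hSε : S ⊆ Metric.ball 0 ε := by
    rintro _ ⟨y, hy, rfl⟩
    rw [mem_ball_zero_iff, norm_smul, Real.norm_of_nonneg hs.le]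
    exact (mul_le_mul_of_nonneg_left (hball y hy) hs.le).trans_lt hsR
  obtain ⟨_, ⟨y, hy, rfl⟩, hsign⟩ := exists_mem_signChangeSet hSconn (hSε.trans hdense)
    (Set.mem_image_of_mem _ haρ) (Set.mem_image_of_mem _ hbρ) hva hvb
  have h3 := hg' y (hball y hy) s hs.le hss₂
  rw [hg _ (hSε (Set.mem_image_of_mem _ hy)) hsign, zero_sub, abs_neg, abs_mul,
    abs_of_pos (pow_pos hs D), pow_succ, mul_left_comm] at h3
  have h4 := le_of_mul_le_mul_left h3 (pow_pos hs D)
  have h5 : c < |eval y (G D)| := hρG y hy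
  linarith

theorem sum_antidiagonal_mul_of_eq_zero {R : Type*} [CommRing R] (q : ℕ → R) {V : ℕ → R} {m : ℕ}
    (hm : ∀ d < m, V d = 0) (e : ℕ) :
    ∑ p ∈ Finset.HasAntidiagonal.antidiagonal (m + e), q p.1 * V p.2 =
      q e * V m + ∑ a ∈ Finset.range e, q a * V (m + e - a) := by
  rw [Finset.Nat.sum_antidiagonal_eq_sum_range_succ (fun a b => q a * V b),
    ← Finset.sum_subset (s₁ := Finset.range (e + 1)), Finset.sum_range_succ, add_comm,
    Nat.add_sub_cancel]
  · exact Finset.range_subset_range.2 (by omega)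
  · intro a ha ha'
    rw [Finset.mem_range] at ha ha'
    rw [hm _ (by omega), mul_zero]

theorem sum_antidiagonal_mul_eq_zero {R : Type*} [CommRing R] (q : ℕ → R) {V : ℕ → R} {m : ℕ}
    (hm : ∀ d < m, V d = 0) {j : ℕ} (hj : j < m) :
    ∑ p ∈ Finset.HasAntidiagonal.antidiagonal j, q p.1 * V p.2 = 0 := by
  refine Finset.sum_eq_zero fun p hp => ?_
  have := Finset.HasAntidiagonal.mem_antidiagonal.1 hp
  rw [hm _ (by omega), mul_zero]

/-- If each term of a sequence can be chosen from the previous ones, provided they were chosen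
correctly, then the whole sequence can be chosen. -/
theorem exists_seq_of_forall_exists {α : Type*} [Inhabited α] (P : ℕ → (ℕ → α) → α → Prop)
    (hcongr : ∀ d q q' c, (∀ i < d, q i = q' i) → P d q c → P d q' c)
    (h : ∀ d q, (∀ i < d, P i q (q i)) → ∃ c, P d q c) :
    ∃ q : ℕ → α, ∀ d, P d q (q d) := by
  classical
  let step : (d : ℕ) → ((i : ℕ) → i < d → α) → α := fun d q =>
    Classical.epsilon (P d fun i => if hi : i < d then q i hi else default)
  let q : ℕ → α := fun d => Nat.strongRecOn d step
  have hq : ∀ d, q d = step d fun i _ => q i := fun d => Nat.strongRecOn_eq step d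
  refine ⟨q, fun d => ?_⟩
  induction d using Nat.strong_induction_on with
  | _ d ih =>
    obtain ⟨c, hc⟩ := h d q ih
    have hagree : ∀ i < d, q i = if i < d then q i else default := fun i hi => by rw [if_pos hi]
    have h1 : P d (fun i => if i < d then q i else default) (q d) := by
      rw [hq d]
      have := Classical.epsilon_spec (p := P d fun i => if i < d then q i else default)
        ⟨c, hcongr d _ _ c hagree hc⟩
      simpa only [step, dite_eq_ite] using this
    exact hcongr d _ _ _ (fun i hi => (hagree i hi).symm) h1

theorem one_add_sum_le_pow_of_le {b : ℕ → ℝ} {C : ℝ} (hC : 0 ≤ C)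
    (h : ∀ d, b d ≤ C * (1 + ∑ i ∈ Finset.range d, b i)) (d : ℕ) :
    1 + ∑ i ∈ Finset.range d, b i ≤ (1 + C) ^ d := by
  induction d with
  | zero => simp
  | succ d ih =>
    rw [Finset.sum_range_succ, pow_succ]
    have := h d
    nlinarith

theorem MvPolynomial.IsHomogeneous.summable_weightedNorm_smul {q : ℕ → MvPolynomial (Fin n) ℝ}
    {ω : Fin n → ℝ} (hω : ∀ i, 0 ≤ ω i) (hq : ∀ d, (q d).IsHomogeneous d) {C : ℝ} (hC : 0 ≤ C)
    (h : ∀ d, weightedNorm ω (q d) ≤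
      C * (1 + ∑ i ∈ Finset.range d, weightedNorm ω (q i))) :
    Summable fun d => weightedNorm ((1 / (2 * (1 + C))) • ω) (q d) := by
  refine Summable.of_nonneg_of_le (fun d => weightedNorm_nonneg (fun i => ?_) _) (fun d => ?_)
    ((summable_geometric_of_lt_one (by norm_num) one_half_lt_one).mul_left C)
  · exact mul_nonneg (by positivity) (hω i)
  · rw [(hq d).weightedNorm_smul]
    have h1 := (h d).trans (mul_le_mul_of_nonneg_left (one_add_sum_le_pow_of_le hC h d) hC)
    calc (1 / (2 * (1 + C))) ^ d * weightedNorm ω (q d)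
        ≤ (1 / (2 * (1 + C))) ^ d * (C * (1 + C) ^ d) := by gcongr
      _ = C * (1 / 2) ^ d := by
        rw [mul_left_comm, ← mul_pow]
        congr 2
        field_simp

end

section

open MvPolynomial

section LocalDivision

variable {N : ℕ} {u v : (Fin (N + 1) → ℝ) → ℝ} {U V : ℕ → MvPolynomial (Fin (N + 1)) ℝ}
  {w : Fin (N + 1) → ℝ} {m : ℕ} {ε : ℝ}

theorem HasHomogeneousExpansion.exists_formal_quotient (hU : HasHomogeneousExpansion u U w)
    (hV : HasHomogeneousExpansion v V w) (hw : ∀ i, 0 < w i) (hm : ∀ d < m, V d = 0)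
    (hVm : V m ≠ 0) (hlap : (V m).laplacian = 0) (hε : 0 < ε)
    (hdense : Metric.ball 0 ε ⊆ closure {y | v y ≠ 0})
    (hcont : ContinuousOn v (Metric.ball 0 ε))
    (hu : ∀ y ∈ Metric.ball 0 ε, y ∈ signChangeSet v → u y = 0) :
    (∀ j < m, U j = 0) ∧ ∃ q : ℕ → MvPolynomial (Fin (N + 1)) ℝ, (∀ d, (q d).IsHomogeneous d) ∧
      ∀ d, q d * V m = U (m + d) - ∑ i ∈ Finset.range d, q i * V (m + d - i) := by
  have hw' : ∀ i, 0 ≤ w i := fun i => (hw i).le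
  have hstep : ∀ (g : (Fin (N + 1) → ℝ) → ℝ) (G : ℕ → MvPolynomial (Fin (N + 1)) ℝ) (D : ℕ),
      HasHomogeneousExpansion g G w → (∀ y ∈ Metric.ball 0 ε, y ∈ signChangeSet v → g y = 0) →
      (∀ d < D, G d = 0) → V m ∣ G D := fun g G D hG hg hD =>
    harmonic_dvd_of_eval_eq_zero_on_signChangeSet (hV.isHomogeneous m) hlap hVm fun z hz =>
      hV.leading_eq_zero_on_signChangeSet hG hw hm hD hε hdense hg hz
  have hUm : ∀ j < m, U j = 0 := by
    intro j
    induction j using Nat.strong_induction_on with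
    | _ j ih =>
      intro hj
      exact (hV.isHomogeneous m).eq_zero_of_dvd hVm (hU.isHomogeneous j)
        (hstep u U j hU hu fun d hd => ih d hd (hd.trans hj)) hj
  refine ⟨hUm, ?_⟩
  suffices hex : ∃ q : ℕ → MvPolynomial (Fin (N + 1)) ℝ, ∀ d, (q d).IsHomogeneous d ∧
      q d * V m = U (m + d) - ∑ i ∈ Finset.range d, q i * V (m + d - i) by
    obtain ⟨q, hq⟩ := hex
    exact ⟨q, fun d => (hq d).1, fun d => (hq d).2⟩
  refine exists_seq_of_forall_exists
    (fun d (q : ℕ → MvPolynomial (Fin (N + 1)) ℝ) c => c.IsHomogeneous d ∧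
      c * V m = U (m + d) - ∑ i ∈ Finset.range d, q i * V (m + d - i)) ?_ ?_
  · rintro d q q' c hqq ⟨hc, hc'⟩
    refine ⟨hc, hc'.trans ?_⟩
    congr 1
    exact Finset.sum_congr rfl fun i hi => by rw [hqq i (Finset.mem_range.1 hi)]
  · intro d q hq
    have hq' : ∀ j, (if j < d then q j else 0).IsHomogeneous j := fun j => by
      split_ifs with hj
      exacts [(hq j hj).1, isHomogeneous_zero _ _ _]
    have hQ := HasHomogeneousExpansion.of_finite (w := w) hq' d
    set Q := fun j => if j < d then if j < d then q j else 0 else 0 with hQdef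
    have hQlt : ∀ j < d, Q j = q j := fun j hj => by simp [Q, hj]
    have hQsum : ∀ e ≤ d, ∑ i ∈ Finset.range e, Q i * V (m + e - i) =
        ∑ i ∈ Finset.range e, q i * V (m + e - i) := fun e he =>
      Finset.sum_congr rfl fun i hi => by rw [hQlt i ((Finset.mem_range.1 hi).trans_le he)]
    have hQd : Q d = 0 := by simp [Q]
    have hG := hU.sub (hQ.mul hV hw') hw'
    have hdvd := hstep _ _ (m + d) hG ?_ ?_
    · rw [sum_antidiagonal_mul_of_eq_zero Q hm, hQd, zero_mul, zero_add,
        hQsum d le_rfl] at hdvd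
      refine (hV.isHomogeneous m).exists_mul_eq_of_dvd ?_ hdvd
      refine (hU.isHomogeneous _).sub (IsHomogeneous.sum _ _ _ fun i hi => ?_)
      rw [Finset.mem_range] at hi
      have h := (hq i hi).1.mul (hV.isHomogeneous (m + d - i))
      rwa [show i + (m + d - i) = m + d by omega] at h
    · intro y hy hsign
      have hvy : v y = 0 := eq_zero_of_mem_signChangeSet hsign
        (hcont.continuousAt (Metric.isOpen_ball.mem_nhds hy))
      simp only [hu y hy hsign, hvy, mul_zero, sub_zero]
    · intro j hj
      rcases lt_or_ge j m with hjm | hjm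
      · rw [hUm j hjm, sum_antidiagonal_mul_eq_zero Q hm hjm, sub_zero]
      · obtain ⟨e, rfl⟩ := Nat.exists_eq_add_of_le hjm
        have he : e < d := by omega
        rw [sum_antidiagonal_mul_of_eq_zero Q hm, hQlt e he, (hq e he).2,
          hQsum e he.le]
        ring

theorem HasHomogeneousExpansion.exists_analyticAt_quotient {r : ℝ} (hr : 0 < r)
    (hU : HasHomogeneousExpansion u U fun _ => r) (hV : HasHomogeneousExpansion v V fun _ => r)
    (hm : ∀ d < m, V d = 0) (hVm : V m ≠ 0) (hlap : (V m).laplacian = 0) (hε : 0 < ε)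
    (hdense : Metric.ball 0 ε ⊆ closure {y | v y ≠ 0})
    (hcont : ContinuousOn v (Metric.ball 0 ε))
    (hu : ∀ y ∈ Metric.ball 0 ε, y ∈ signChangeSet v → u y = 0) :
    ∃ f : (Fin (N + 1) → ℝ) → ℝ, AnalyticAt ℝ f 0 ∧ ∀ᶠ y in nhds 0, u y = f y * v y := by
  obtain ⟨hUm, q, hqh, hq⟩ :=
    hU.exists_formal_quotient hV (fun _ => hr) hm hVm hlap hε hdense hcont hu
  obtain ⟨ω, hω, κ, hκ, hdiv⟩ := exists_mul_weightedNorm_le_weightedNorm_mul hVm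
  have hΩ : 0 < 1 + ∑ i, ω i := by linarith [Finset.sum_nonneg fun i (_ : i ∈ Finset.univ) =>
    (hω i).le]
  set t := r / (1 + ∑ i, ω i) with ht
  have ht0 : 0 < t := by positivity
  have htω : ∀ i, (t • ω) i ≤ r := fun i => by
    rw [Pi.smul_apply, smul_eq_mul, ht, div_mul_eq_mul_div, div_le_iff₀ hΩ]
    have := Finset.single_le_sum (fun i (_ : i ∈ Finset.univ) => (hω i).le) (Finset.mem_univ i)
    gcongr
    linarith
  have htω0 : ∀ i, 0 < (t • ω) i := fun i => mul_pos ht0 (hω i)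
  have htω' : ∀ i, 0 ≤ (t • ω) i := fun i => (htω0 i).le
  have hU' := hU.mono htω' htω
  have hV' := hV.mono htω' htω
  set A := max (∑' j, weightedNorm (t • ω) (U j)) (∑' j, weightedNorm (t • ω) (V j)) with hA
  have hUA : ∀ j, weightedNorm (t • ω) (U j) ≤ A := fun j =>
    (hU'.summable.le_tsum j fun _ _ => weightedNorm_nonneg htω' _).trans (le_max_left _ _)
  have hVA : ∀ j, weightedNorm (t • ω) (V j) ≤ A := fun j =>
    (hV'.summable.le_tsum j fun _ _ => weightedNorm_nonneg htω' _).trans (le_max_right _ _)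
  have hA0 : 0 ≤ A := (weightedNorm_nonneg htω' _).trans (hUA 0)
  have hrec : ∀ d, weightedNorm (t • ω) (q d) ≤ A / (κ * t ^ m) *
      (1 + ∑ i ∈ Finset.range d, weightedNorm (t • ω) (q i)) := by
    intro d
    have h1 : κ * t ^ m * weightedNorm (t • ω) (q d) ≤ weightedNorm (t • ω) (q d * V m) := by
      rw [((hqh d).mul (hV.isHomogeneous m)).weightedNorm_smul, (hqh d).weightedNorm_smul]
      calc κ * t ^ m * (t ^ d * weightedNorm ω (q d))
          = t ^ (d + m) * (κ * weightedNorm ω (q d)) := by ring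
        _ ≤ _ := by
          gcongr
          exact hdiv (q d)
    have h2 : weightedNorm (t • ω) (q d * V m) ≤
        A + ∑ i ∈ Finset.range d, weightedNorm (t • ω) (q i) * A := by
      rw [hq d]
      refine (weightedNorm_sub_le htω' _ _).trans (add_le_add (hUA _) ?_)
      refine (weightedNorm_sum_le htω' _ _).trans (Finset.sum_le_sum fun i _ => ?_)
      exact (weightedNorm_mul_le htω' _ _).trans
        (mul_le_mul_of_nonneg_left (hVA _) (weightedNorm_nonneg htω' _))
    rw [← Finset.sum_mul] at h2
    rw [div_mul_eq_mul_div, le_div_iff₀ (by positivity)]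
    linarith
  have hC : 0 ≤ A / (κ * t ^ m) := by positivity
  have hsum := IsHomogeneous.summable_weightedNorm_smul htω' hqh hC hrec
  set C := A / (κ * t ^ m) with hCdef
  set W := (1 / (2 * (1 + C))) • (t • ω) with hW
  have hW0 : ∀ i, 0 < W i := fun i => mul_pos (by positivity) (htω0 i)
  have hW' : ∀ i, 0 ≤ W i := fun i => (hW0 i).le
  have hWle : ∀ i, W i ≤ (t • ω) i := fun i => by
    refine mul_le_of_le_one_left (htω' i) ?_
    rw [div_le_one (by positivity)]
    linarith
  have hQ : HasHomogeneousExpansion (fun y => ∑' j, eval y (q j)) q W :=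
    ⟨hqh, hsum, fun y hy => (Summable.of_norm_bounded hsum fun j =>
      abs_eval_le_weightedNorm hy _).hasSum⟩
  have hprod := hQ.mul (hV'.mono hW' hWle) hW'
  refine ⟨_, hQ.analyticAt hW0, ?_⟩
  obtain ⟨δ, hδ, hδW⟩ := exists_pos_forall_le hW0
  filter_upwards [Metric.closedBall_mem_nhds 0 hδ] with y hy
  have hyW : ∀ i, |y i| ≤ W i := fun i =>
    ((norm_le_pi_norm y i).trans (mem_closedBall_zero_iff.1 hy)).trans (hδW i)
  refine ((hU'.mono hW' hWle).hasSum y hyW).unique ?_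
  convert hprod.hasSum y hyW using 3 with j
  rcases lt_or_ge j m with hjm | hjm
  · rw [hUm j hjm, sum_antidiagonal_mul_eq_zero q hm hjm]
  · obtain ⟨e, rfl⟩ := Nat.exists_eq_add_of_le hjm
    rw [sum_antidiagonal_mul_of_eq_zero q hm, hq e]
    ring

end LocalDivision

end

section

open MvPolynomial

theorem mem_signChangeSet_comp_const_add {n : ℕ} {f : (Fin n → ℝ) → ℝ} {a y : Fin n → ℝ} :
    y ∈ signChangeSet (fun y => f (a + y)) ↔ a + y ∈ signChangeSet f := by
  have h : ∀ s : Set (Fin n → ℝ), y ∈ closure ((fun y => a + y) ⁻¹' s) ↔ a + y ∈ closure s :=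
    fun s => by
      rw [show closure ((fun y => a + y) ⁻¹' s) = (fun y => a + y) ⁻¹' closure s from
        ((Homeomorph.addLeft a).preimage_closure s).symm]
      rfl
  exact and_congr (h {x | 0 < f x}) (h {x | f x < 0})

section GlobalDivision

variable {N : ℕ} {Ω : Set (Fin (N + 1) → ℝ)} {u v : (Fin (N + 1) → ℝ) → ℝ}

theorem exists_analyticAt_quotient_of_signChangeSet (hΩ : IsOpen Ω) {x₀ : Fin (N + 1) → ℝ}
    (hx₀ : x₀ ∈ Ω) (hu : AnalyticAt ℝ u x₀) (hv : AnalyticOnNhd ℝ v Ω) (hmean : HasWeightedMean v Ω)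
    (hdense : Ω ⊆ closure {x | v x ≠ 0}) (h : ∀ z ∈ Ω, z ∈ signChangeSet v → u z = 0) :
    ∃ f : (Fin (N + 1) → ℝ) → ℝ, AnalyticAt ℝ f x₀ ∧ ∀ᶠ x in nhds x₀, u x = f x * v x := by
  classical
  obtain ⟨U, r₁, hr₁, hU⟩ := hu.exists_hasHomogeneousExpansion
  obtain ⟨V, r₂, hr₂, hV⟩ := (hv x₀ hx₀).exists_hasHomogeneousExpansion
  set r := min r₁ r₂
  have hr : 0 < r := lt_min hr₁ hr₂
  replace hU := hU.mono (w' := fun _ => r) (fun _ => hr.le) fun _ => min_le_left _ _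
  replace hV := hV.mono (w' := fun _ => r) (fun _ => hr.le) fun _ => min_le_right _ _
  have hshift : Continuous fun y : Fin (N + 1) → ℝ => x₀ + y := by fun_prop
  set B := (fun y : Fin (N + 1) → ℝ => x₀ + y) ⁻¹' Ω with hB
  have hBo : IsOpen B := hΩ.preimage hshift
  have hB0 : B ∈ nhds 0 := hBo.mem_nhds (by simpa [hB] using hx₀)
  have hcont : ContinuousOn (fun y => v (x₀ + y)) B :=
    hv.continuousOn.comp hshift.continuousOn fun y hy => hy
  have hdense' : B ⊆ closure {y | v (x₀ + y) ≠ 0} := by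
    intro y hy
    have h1 := (Homeomorph.addLeft x₀).preimage_closure {x | v x ≠ 0}
    exact h1.subset (hdense hy)
  have hex : ∃ m, V m ≠ 0 := by
    by_contra! hall
    obtain ⟨y, hy, hvy⟩ := mem_closure_iff_nhds.1 (hdense' (mem_of_mem_nhds hB0)) _
      (Metric.closedBall_mem_nhds 0 hr)
    refine hvy ((hV.hasSum y fun i => ?_).unique ?_)
    · exact (norm_le_pi_norm y i).trans (mem_closedBall_zero_iff.1 hy)
    · simp [hall]
  have hm : ∀ d < Nat.find hex, V d = 0 := fun d hd => not_not.1 (Nat.find_min hex hd)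
  have hlap := laplacian_eq_zero_of_hasWeightedMean (hV.hasWeightedMean_leading (fun _ => hr) hm hB0
    hcont (hmean.comp_const_add x₀))
  obtain ⟨ε, hε, hεB⟩ := Metric.nhds_basis_ball.mem_iff.1 hB0
  obtain ⟨f, hf, hfe⟩ := hU.exists_analyticAt_quotient hr hV hm (Nat.find_spec hex) hlap hε
    (hεB.trans hdense') (hcont.mono hεB) fun y hy hs =>
      h _ (hεB hy) (mem_signChangeSet_comp_const_add.1 hs)
  have hsub : AnalyticAt ℝ (fun x : Fin (N + 1) → ℝ => x - x₀) x₀ :=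
    analyticAt_id.sub analyticAt_const
  refine ⟨fun x => f (x - x₀), AnalyticAt.fun_comp (by rwa [sub_self]) hsub, ?_⟩
  have ht : Filter.Tendsto (fun x => x - x₀) (nhds x₀) (nhds 0) := by
    simpa using hsub.continuousAt.tendsto
  filter_upwards [ht.eventually hfe] with x hx
  simpa using hx

/-- The division theorem: an analytic function vanishing wherever the harmonic function `v` changes
sign is an analytic multiple of `v`. -/
theorem exists_analyticOnNhd_quotient (hΩ : IsOpen Ω) (hconn : IsPreconnected Ω)
    (hu : AnalyticOnNhd ℝ u Ω) (hv : AnalyticOnNhd ℝ v Ω) (hmean : HasWeightedMean v Ω)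
    (hv0 : ¬ ∀ x ∈ Ω, v x = 0) (h : ∀ z ∈ Ω, z ∈ signChangeSet v → u z = 0) :
    ∃ f : (Fin (N + 1) → ℝ) → ℝ, AnalyticOnNhd ℝ f Ω ∧ ∀ x ∈ Ω, u x = f x * v x := by
  have hdense : Ω ⊆ closure {x | v x ≠ 0} := by
    intro x hx
    by_contra hcl
    refine hv0 (hv.eqOn_zero_of_preconnected_of_eventuallyEq_zero hconn hx ?_)
    filter_upwards [isClosed_closure.isOpen_compl.mem_nhds hcl] with y hy
    by_contra hvy
    exact hy (subset_closure hvy)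
  have hloc : ∀ x : Fin (N + 1) → ℝ, ∃ f : (Fin (N + 1) → ℝ) → ℝ, x ∈ Ω →
      AnalyticAt ℝ f x ∧ ∀ᶠ y in nhds x, u y = f y * v y := by
    intro x
    by_cases hx : x ∈ Ω
    · obtain ⟨f, hf⟩ :=
        exists_analyticAt_quotient_of_signChangeSet hΩ hx (hu x hx) hv hmean hdense h
      exact ⟨f, fun _ => hf⟩
    · exact ⟨0, fun hx' => absurd hx' hx⟩
  choose F hF using hloc
  refine ⟨fun x => F x x, fun x₀ hx₀ => ?_, fun x hx => (hF x hx).2.self_of_nhds⟩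
  refine (hF x₀ hx₀).1.congr ?_
  filter_upwards [hΩ.mem_nhds hx₀, (hF x₀ hx₀).1.eventually_analyticAt,
    eventually_eventually_nhds.2 (hF x₀ hx₀).2] with x hx han heq
  have hne : (nhdsWithin x {y | v y ≠ 0}).NeBot := mem_closure_iff_nhdsWithin_neBot.1 (hdense hx)
  refine tendsto_nhds_unique_of_eventuallyEq
    (han.continuousAt.tendsto.mono_left (nhdsWithin_le_nhds (s := {y | v y ≠ 0})))
    ((hF x hx).1.continuousAt.tendsto.mono_left nhdsWithin_le_nhds) ?_
  filter_upwards [nhdsWithin_le_nhds heq, nhdsWithin_le_nhds (hF x hx).2, self_mem_nhdsWithin]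
    with y h1 h2 hvy
  exact mul_right_cancel₀ hvy (h1.symm.trans h2)

end GlobalDivision

end

/-- Near a sign change, the zero set of a continuous function has positive codimension one
Hausdorff measure. -/
theorem hausdorffMeasure_ne_zero_of_mem_signChangeSet {N : ℕ} {Ω U : Set (Fin (N + 1) → ℝ)}
    (hΩ : IsOpen Ω) {v : (Fin (N + 1) → ℝ) → ℝ} (hv : ContinuousOn v Ω) {z : Fin (N + 1) → ℝ}
    (hzΩ : z ∈ Ω) (hz : z ∈ signChangeSet v) (hU : U ∈ nhds z) :
    μH[(N : ℝ)] ({x ∈ Ω | v x = 0} ∩ U) ≠ 0 := by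
  obtain ⟨ε, hε, hεU⟩ := Metric.nhds_basis_ball.mem_iff.1 (Filter.inter_mem (hΩ.mem_nhds hzΩ) hU)
  set B := Metric.ball z ε
  have hBo : IsOpen B := Metric.isOpen_ball
  have hvB : ContinuousOn v B := hv.mono fun x hx => (hεU hx).1
  obtain ⟨a, haB, ha⟩ := mem_closure_iff_nhds.1 hz.1 _ (Metric.ball_mem_nhds z hε)
  obtain ⟨b, hbB, hb⟩ := mem_closure_iff_nhds.1 hz.2 _ (Metric.ball_mem_nhds z hε)
  rw [Set.mem_ofPred] at ha hb
  have hab : b - a ≠ 0 := sub_ne_zero.2 (by rintro rfl; exact lt_asymm ha hb)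
  obtain ⟨i, hi⟩ := Function.ne_iff.1 hab
  set c := b - a with hc
  let P : (Fin (N + 1) → ℝ) →L[ℝ] (Fin N → ℝ) := ContinuousLinearMap.pi fun j =>
    ContinuousLinearMap.proj (i.succAbove j) -
      (c (i.succAbove j) / c i) • ContinuousLinearMap.proj i
  have hP : ∀ x j, P x j = x (i.succAbove j) - c (i.succAbove j) / c i * x i := fun x j => rfl
  have hPc : P c = 0 := by
    ext j
    rw [hP, div_mul_cancel₀ _ hi, sub_self]
    rfl
  let lift : (Fin N → ℝ) → Fin (N + 1) → ℝ := fun q => i.insertNth (0 : ℝ) q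
  have hlift : Continuous lift := by
    refine continuous_pi fun k => ?_
    refine Fin.succAboveCases i ?_ (fun j => ?_) k
    · simpa [lift] using continuous_const
    · simpa [lift] using continuous_apply j
  have hlift0 : lift 0 = 0 := by
    ext k
    refine Fin.succAboveCases i ?_ (fun j => ?_) k <;> simp [lift]
  have hPlift : ∀ q, P (lift q) = q := fun q => by
    ext j
    simp [hP, lift]
  have hnear : ∀ x ∈ B, ∀ O : Set ℝ, IsOpen O → v x ∈ O →
      ∀ᶠ q in nhds (0 : Fin N → ℝ), x + lift q ∈ B ∧ v (x + lift q) ∈ O := by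
    intro x hx O hO hvx
    have ht : Filter.Tendsto (fun q => x + lift q) (nhds 0) (nhds x) := by
      have hcont : Continuous fun q => x + lift q := by fun_prop
      simpa [hlift0] using hcont.tendsto 0
    exact (ht.eventually (hBo.mem_nhds hx)).and
      (ht.eventually ((hvB.continuousAt (hBo.mem_nhds hx)).eventually (hO.mem_nhds hvx)))
  have hnhds : P '' ({x ∈ Ω | v x = 0} ∩ U) ∈ nhds (P a) := by
    have hsub : Filter.Tendsto (fun p => p - P a) (nhds (P a)) (nhds 0) := by
      have hcont : Continuous fun p => p - P a := by fun_prop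
      simpa using hcont.tendsto (P a)
    filter_upwards [hsub.eventually (hnear a haB _ isOpen_Ioi ha),
      hsub.eventually (hnear b hbB _ isOpen_Iio hb)] with p hpa hpb
    set q := p - P a with hq
    have hseg : segment ℝ (a + lift q) (b + lift q) ⊆ B :=
      (convex_ball z ε).segment_subset hpa.1 hpb.1
    obtain ⟨x, hx, hvx⟩ := (convex_segment (a + lift q) (b + lift q)).isPreconnected.intermediate_value
      (right_mem_segment ℝ _ _) (left_mem_segment ℝ _ _) (hvB.mono hseg)
      (Set.mem_Icc.2 ⟨(Set.mem_Iio.1 hpb.2).le, (Set.mem_Ioi.1 hpa.2).le⟩)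
    have hxB := hεU (hseg hx)
    refine ⟨x, ⟨⟨hxB.1, hvx⟩, hxB.2⟩, ?_⟩
    rw [segment_eq_image'] at hx
    obtain ⟨t, -, rfl⟩ := hx
    simp only [add_sub_add_right_eq_sub, ← hc, map_add, map_smul, hPc, hPlift, smul_zero, add_zero]
    rw [hq, add_sub_cancel]
  intro hzero
  have himage := P.lipschitz.hausdorffMeasure_image_le (Nat.cast_nonneg N)
    ({x ∈ Ω | v x = 0} ∩ U)
  rw [hzero, mul_zero, nonpos_iff_eq_zero] at himage
  have hvol := hausdorffMeasure_pi_real (ι := Fin N)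
  rw [Fintype.card_fin] at hvol
  rw [hvol] at himage
  exact (Measure.measure_pos_of_mem_nhds volume hnhds).ne' himage

/-- Simultaneous division: if `u` is real analytic and `v₁, …, v_k` are harmonic on a
domain `Ω ⊆ ℝⁿ` (`n ≥ 2`), none identically zero, with `Z(vᵢ) ⊆ Z(u)` for every `i`
and `H^{n-1}(Z(vᵢ) ∩ Z(vⱼ)) = 0` for `i ≠ j`, then `u = f·∏ᵢ vᵢ` for some real
analytic `f` on `Ω`. -/
theorem stmt19 {n k : ℕ} (hn : 2 ≤ n) (Ω : Set (Fin n → ℝ)) (hΩ : IsOpen Ω)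
    (hconn : IsConnected Ω) (u : (Fin n → ℝ) → ℝ) (hu : AnalyticOn ℝ u Ω)
    (v : Fin k → (Fin n → ℝ) → ℝ) (hv : ∀ i, IsHarmonicOn (v i) Ω)
    (hv0 : ∀ i, ¬ ∀ x ∈ Ω, v i x = 0)
    (hZ : ∀ i, ∀ x ∈ Ω, v i x = 0 → u x = 0)
    (hdisj : ∀ i j, i ≠ j →
      μH[(n : ℝ) - 1] ({x ∈ Ω | v i x = 0} ∩ {x ∈ Ω | v j x = 0}) = 0) :
    ∃ f : (Fin n → ℝ) → ℝ, AnalyticOn ℝ f Ω ∧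
      ∀ x ∈ Ω, u x = f x * ∏ i, v i x := by
  obtain ⟨N, rfl⟩ := Nat.exists_eq_add_of_le' (one_le_two.trans hn)
  have hdim : ((N + 1 : ℕ) : ℝ) - 1 = N := by push_cast; ring
  rw [hdim] at hdisj
  have hmean : ∀ i, HasWeightedMean (v i) Ω := fun i =>
    hasWeightedMean_of_coordLaplacian_eq_zero hΩ (hv i).1 (hv i).2
  have hcont : ∀ i, ContinuousOn (v i) Ω := fun i => (hv i).1.continuousOn
  have han : ∀ i, AnalyticOnNhd ℝ (v i) Ω := fun i => (hmean i).analyticOnNhd hΩ (hcont i)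
  suffices hs : ∀ s : Finset (Fin k), ∃ f : (Fin (N + 1) → ℝ) → ℝ, AnalyticOnNhd ℝ f Ω ∧
      ∀ x ∈ Ω, u x = f x * ∏ i ∈ s, v i x by
    obtain ⟨f, hf, hfe⟩ := hs Finset.univ
    exact ⟨f, hf.analyticOn, hfe⟩
  intro s
  induction s using Finset.induction_on with
  | empty => exact ⟨u, hΩ.analyticOn_iff_analyticOnNhd.1 hu, by simp⟩
  | insert j s hj ih =>
    obtain ⟨g, hg, hge⟩ := ih
    obtain ⟨f, hf, hfe⟩ := exists_analyticOnNhd_quotient hΩ hconn.isPreconnected hg (han j)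
      (hmean j) (hv0 j) fun z hzΩ hz => by
        by_contra hgz
        refine hausdorffMeasure_ne_zero_of_mem_signChangeSet hΩ (hcont j) hzΩ hz
          ((hg z hzΩ).continuousAt.eventually_ne hgz) (measure_mono_null ?_
            ((measure_biUnion_null_iff (Finset.countable_toSet s)).2 fun i hi =>
              hdisj i j (ne_of_mem_of_not_mem hi hj)))
        rintro x ⟨⟨hxΩ, hvx⟩, hgx⟩
        have hprod := hge x hxΩ
        rw [hZ j x hxΩ hvx, eq_comm, mul_eq_zero, Finset.prod_eq_zero_iff] at hprod
        obtain ⟨i, hi, hvi⟩ := hprod.resolve_left hgx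
        exact Set.mem_biUnion hi ⟨⟨hxΩ, hvi⟩, hxΩ, hvx⟩
    refine ⟨f, hf, fun x hx => ?_⟩
    rw [Finset.prod_insert hj, ← mul_assoc, ← hfe x hx, hge x hx]
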